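/- arXiv:1311.3240 — 2 statements merged into one kernel-verified Lean document; each statement's English description precedes it below -/
import Mathlib

section
/- Let n be a positive integer and let 𝒜ₙ be a nonempty bridge-alterable set of simple graphs on vertex set {1,…,n}. Then |{G ∈ 𝒜ₙ : G is connected}| / |𝒜ₙ| ≥ min over integers t with 1 ≤ t ≤ n of max{ e^{-t/n}, |𝒯ₜ| / |ℱₜ| }. -/
/-- A set of simple graphs on a fixed vertex set is bridge-alterable if for every
graph `G` and every bridge `e` of `G`, `G` is in the set iff `G - e` is. -/
def BridgeAlterable {n : ℕ} (A : Set (SimpleGraph (Fin n))) : Prop :=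
  ∀ (G : SimpleGraph (Fin n)) (e : Sym2 (Fin n)), G.IsBridge e →
    (G ∈ A ↔ G.deleteEdges {e} ∈ A)

/-- The number of trees on vertex set `{1,…,t}`. -/
noncomputable def treeCount (t : ℕ) : ℕ :=
  {T : SimpleGraph (Fin t) | T.IsTree}.ncard

/-- The number of forests on vertex set `{1,…,t}`. -/
noncomputable def forestCount (t : ℕ) : ℕ :=
  {F : SimpleGraph (Fin t) | F.IsAcyclic}.ncard

open Finset Function

section Weights

variable {ι : Type*} [DecidableEq ι]

/-- The weight vector obtained from `w` by moving the weight of `j` onto `i`. -/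
def merge (w : ι → ℝ) (i j : ι) : ι → ℝ :=
  fun k => if k = j then 0 else if k = i then w i + w j else w k

/-- The weight vector obtained from `w` by setting the weights in `T` to zero. -/
def clear (w : ι → ℝ) (T : Finset ι) : ι → ℝ :=
  fun k => if k ∈ T then 0 else w k

/-- The weight vector obtained from `w` by giving `p` weight `x` and `q` weight `y`. -/
def setPair (w : ι → ℝ) (p q : ι) (x y : ℝ) : ι → ℝ :=
  fun k => if k = q then y else if k = p then x else w k

lemma merge_eq_zero_of_notMem {S : Finset ι} {w : ι → ℝ} (hw : ∀ k ∉ S, w k = 0) {i : ι}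
    (hi : i ∈ S) (j : ι) : ∀ k ∉ S.erase j, merge w i j k = 0 := by
  intro k hk
  simp only [merge]
  split_ifs with h1 h2
  · rfl
  · exact absurd (mem_erase.mpr ⟨h1, h2 ▸ hi⟩) hk
  · exact hw k fun h => hk (mem_erase.mpr ⟨h1, h⟩)

lemma one_le_merge {S : Finset ι} {w : ι → ℝ} (hw : ∀ k ∈ S, 1 ≤ w k) {i j : ι} (hi : i ∈ S)
    (hj : j ∈ S) : ∀ k ∈ S.erase j, 1 ≤ merge w i j k := by
  intro k hk
  obtain ⟨h1, h2⟩ := mem_erase.mp hk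
  simp only [merge, if_neg h1]
  split_ifs
  · linarith [hw i hi, hw j hj]
  · exact hw k h2

lemma merge_nonneg {w : ι → ℝ} (hw : ∀ k, 0 ≤ w k) (i j k : ι) : 0 ≤ merge w i j k := by
  unfold merge
  split_ifs
  exacts [le_rfl, add_nonneg (hw _) (hw _), hw _]

/-- The weighted number of trees on `V` together with a further vertex of weight `x`, where a tree
is weighted by the product of the vertex weights raised to the degrees. -/
noncomputable def treeWeight (x : ℝ) (V : Finset ι) (w : ι → ℝ) : ℝ :=
  if V = ∅ then 1 else x * (∏ k ∈ V, w k) * (x + ∑ k ∈ V, w k) ^ (#V - 1)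

lemma treeWeight_empty (x : ℝ) (w : ι → ℝ) : treeWeight x ∅ w = 1 := if_pos rfl

lemma treeWeight_of_nonempty (x : ℝ) {V : Finset ι} (hV : V.Nonempty) (w : ι → ℝ) :
    treeWeight x V w = x * (∏ k ∈ V, w k) * (x + ∑ k ∈ V, w k) ^ (#V - 1) :=
  if_neg hV.ne_empty

lemma treeWeight_eq_zero (x : ℝ) {V : Finset ι} (w : ι → ℝ) {j : ι} (hj : j ∈ V)
    (hw : w j = 0) : treeWeight x V w = 0 := by
  rw [treeWeight_of_nonempty x ⟨j, hj⟩, prod_eq_zero hj hw]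
  ring

lemma treeWeight_congr (x : ℝ) {V : Finset ι} {w w' : ι → ℝ} (h : ∀ k ∈ V, w k = w' k) :
    treeWeight x V w = treeWeight x V w' := by
  unfold treeWeight
  rw [prod_congr rfl h, sum_congr rfl h]

/-- Counting the weighted trees on `V` and a further vertex by their edges. -/
lemma treeWeight_contract (x : ℝ) (V : Finset ι) (w : ι → ℝ) :
    2 * (#V : ℝ) * treeWeight x V w =
      ∑ j ∈ V, (2 * (x * w j * treeWeight (x + w j) (V.erase j) w) +
        ∑ i ∈ V.erase j, w i * w j * treeWeight x (V.erase j) (merge w i j)) := by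
  rcases V.eq_empty_or_nonempty with rfl | hV
  · simp
  rcases (Nat.one_le_iff_ne_zero.mpr hV.card_ne_zero).eq_or_lt with h1 | h1
  · obtain ⟨a, rfl⟩ := card_eq_one.mp h1.symm
    simp [treeWeight]
  · obtain ⟨v, hv⟩ : ∃ v, #V = v + 2 := ⟨#V - 2, by omega⟩
    set Y : ℝ := ∑ k ∈ V, w k with hY
    set π₀ : ℝ := ∏ k ∈ V, w k with hπ
    have hne {j : ι} (hj : j ∈ V) : (V.erase j).Nonempty := by
      rw [← card_pos, card_erase_of_mem hj]; omega
    have hcard {j : ι} (hj : j ∈ V) : #(V.erase j) - 1 = v := by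
      rw [card_erase_of_mem hj]; omega
    have e1 {j : ι} (hj : j ∈ V) : x * w j * treeWeight (x + w j) (V.erase j) w =
        x * π₀ * (x + Y) ^ v * (x + w j) := by
      rw [treeWeight_of_nonempty _ (hne hj), hcard hj, hπ, ← mul_prod_erase V w hj, hY,
        ← add_sum_erase V w hj]
      ring
    have e2 {i j : ι} (hj : j ∈ V) (hi : i ∈ V.erase j) :
        w i * w j * treeWeight x (V.erase j) (merge w i j) =
          x * π₀ * (x + Y) ^ v * (w i + w j) := by
      have hm : ∀ k ∈ (V.erase j).erase i, merge w i j k = w k := by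
        intro k hk
        simp only [mem_erase] at hk
        simp [merge, hk]
      have hmi : merge w i j i = w i + w j := by simp [merge, (mem_erase.mp hi).1]
      rw [treeWeight_of_nonempty _ (hne hj), hcard hj, hπ, ← mul_prod_erase V w hj, hY,
        ← add_sum_erase V w hj, ← mul_prod_erase _ w hi, ← add_sum_erase _ w hi,
        ← mul_prod_erase _ (merge w i j) hi, ← add_sum_erase _ (merge w i j) hi,
        prod_congr rfl hm, sum_congr rfl hm, hmi]
      ring
    have e3 {j : ι} (hj : j ∈ V) :
        ∑ i ∈ V.erase j, w i * w j * treeWeight x (V.erase j) (merge w i j) =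
          x * π₀ * (x + Y) ^ v * (Y + (v : ℝ) * w j) := by
      rw [sum_congr rfl fun i hi => e2 hj hi, ← mul_sum, sum_add_distrib, sum_const,
        card_erase_of_mem hj, hv, hY, ← add_sum_erase V w hj]
      have : v + 2 - 1 = v + 1 := rfl
      rw [this, nsmul_eq_mul]
      push_cast
      ring
    rw [sum_congr rfl fun j hj => by rw [e1 hj, e3 hj], treeWeight_of_nonempty _ hV, ← hπ, ← hY,
      hv]
    have : ∀ j, 2 * (x * π₀ * (x + Y) ^ v * (x + w j)) + x * π₀ * (x + Y) ^ v * (Y + v * w j) =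
        x * π₀ * (x + Y) ^ v * (2 * x + Y + (v + 2) * w j) := fun j => by ring
    simp only [this]
    rw [← mul_sum, sum_add_distrib, sum_const, ← mul_sum, ← hY, hv]
    simp
    ring

lemma sum_sum_powerset_erase (R : Finset ι) (g : ι → Finset ι → ℝ) :
    ∑ j ∈ R, ∑ V ∈ R.powerset with j ∉ V, g j V =
      ∑ V ∈ R.powerset, ∑ j ∈ V, g j (V.erase j) := by
  rw [sum_sigma', sum_sigma']
  refine sum_bij' (fun a _ => ⟨insert a.1 a.2, a.1⟩) (fun a _ => ⟨a.2, a.1.erase a.2⟩) ?_ ?_ ?_ ?_ ?_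
  · rintro ⟨j, V⟩ h
    simp only [mem_sigma, mem_filter, mem_powerset] at h ⊢
    exact ⟨insert_subset h.1 h.2.1, mem_insert_self _ _⟩
  · rintro ⟨V, j⟩ h
    simp only [mem_sigma, mem_filter, mem_powerset] at h ⊢
    exact ⟨h.1 h.2, (erase_subset _ _).trans h.1, notMem_erase _ _⟩
  · rintro ⟨j, V⟩ h
    simp only [mem_sigma, mem_filter, mem_powerset] at h
    simp [erase_insert h.2.2]
  · rintro ⟨V, j⟩ h
    simp only [mem_sigma, mem_powerset] at h
    simp [insert_erase h.2]
  · rintro ⟨j, V⟩ h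
    simp only [mem_sigma, mem_filter, mem_powerset] at h
    simp [erase_insert h.2.2]

lemma descFactorial_succ_left (m v : ℕ) :
    (m + 1).descFactorial v = m.descFactorial v + v * m.descFactorial (v - 1) := by
  cases v with
  | zero => simp
  | succ k =>
    rw [Nat.succ_descFactorial_succ, Nat.descFactorial_succ, Nat.add_sub_cancel, ← add_mul]
    rcases le_or_gt k m with h | h
    · congr 1; omega
    · simp [Nat.descFactorial_of_lt h]

/-- The number of trees on `v` vertices of weight one and a further vertex of weight `x`, weighted
by the power of `x` whose exponent is the degree of the latter. -/
noncomputable def starWeight (x : ℝ) (v : ℕ) : ℝ :=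
  if v = 0 then 1 else x * (x + v) ^ (v - 1)

lemma starWeight_pos {x : ℝ} (hx : 0 < x) (v : ℕ) : 0 < starWeight x v := by
  unfold starWeight
  split_ifs <;> positivity

lemma treeWeight_eq_starWeight (x : ℝ) {V : Finset ι} {w : ι → ℝ} (h : ∀ k ∈ V, w k = 1) :
    treeWeight x V w = starWeight x #V := by
  simp [treeWeight, starWeight, prod_congr rfl h, sum_congr rfl h]

lemma pow_mul_succ_pow_le {a b : ℝ} (k : ℕ) (hb : 0 < b) (hab : b ≤ a) (hk : (k : ℝ) ≤ b) :
    a ^ k * (b + 1) ^ (k + 1) ≤ b ^ k * (a + 1) ^ (k + 1) := by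
  have ha : 0 < a := hb.trans_le hab
  have hx : (a - b) / ((b + 1) * a) ≤ 1 := by
    rw [div_le_one (by positivity)]
    nlinarith
  have h1 := one_add_mul_le_pow (a := -((a - b) / ((b + 1) * a))) (by linarith) k
  have h2 : 1 + -((a - b) / ((b + 1) * a)) = (a + 1) * b / ((b + 1) * a) := by
    field_simp
    ring
  have h3 : (b + 1) / (a + 1) ≤ 1 + (k : ℝ) * -((a - b) / ((b + 1) * a)) := by
    have : 1 + (k : ℝ) * -((a - b) / ((b + 1) * a)) - (b + 1) / (a + 1) =
        (a - b) * ((b + 1) * a - k * (a + 1)) / ((a + 1) * ((b + 1) * a)) := by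
      field_simp
      ring
    have h4 : 0 ≤ (a - b) * ((b + 1) * a - k * (a + 1)) / ((a + 1) * ((b + 1) * a)) := by
      apply div_nonneg (mul_nonneg (by linarith) _) (by positivity)
      nlinarith
    linarith
  have h5 := h3.trans h1
  rw [h2, div_pow, div_le_div_iff₀ (by positivity) (by positivity), mul_pow, mul_pow] at h5
  calc a ^ k * (b + 1) ^ (k + 1) = (b + 1) * ((b + 1) ^ k * a ^ k) := by ring
    _ ≤ _ := h5
    _ = _ := by ring

lemma starWeight_mul_le {x : ℝ} (hx : 1 ≤ x) {v u : ℕ} (h : v ≤ u) :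
    starWeight x v * starWeight 1 u ≤ starWeight 1 v * starWeight x u := by
  have hpos : 0 < x := one_pos.trans_le hx
  induction u, h using Nat.le_induction with
  | base => rw [mul_comm]
  | succ u _ ih =>
    have hstep : starWeight x u * starWeight 1 (u + 1) ≤ starWeight 1 u * starWeight x (u + 1) := by
      rcases u with _ | k
      · simpa [starWeight] using hx
      · have := pow_mul_succ_pow_le (a := x + k + 1) (b := k + 2) k (by positivity) (by linarith)
          (by linarith)
        have e1 : (1 : ℝ) + ((k + 1 : ℕ) : ℝ) = k + 2 := by push_cast; ring
        have e2 : (1 : ℝ) + ((k + 1 + 1 : ℕ) : ℝ) = k + 2 + 1 := by push_cast; ring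
        have e3 : x + ((k + 1 : ℕ) : ℝ) = x + k + 1 := by push_cast; ring
        have e4 : x + ((k + 1 + 1 : ℕ) : ℝ) = x + k + 1 + 1 := by push_cast; ring
        simp only [starWeight, Nat.succ_ne_zero, if_false, Nat.add_sub_cancel, e1, e2, e3, e4]
        nlinarith
    have hu := starWeight_pos hpos u
    have h1u := starWeight_pos one_pos u
    have h1 := starWeight_pos one_pos v
    have h2 := starWeight_pos one_pos (u + 1)
    refine le_of_mul_le_mul_right ?_ h1u
    calc starWeight x v * starWeight 1 (u + 1) * starWeight 1 u
        = starWeight x v * starWeight 1 u * starWeight 1 (u + 1) := by ring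
      _ ≤ starWeight 1 v * starWeight x u * starWeight 1 (u + 1) := by gcongr
      _ = starWeight 1 v * (starWeight x u * starWeight 1 (u + 1)) := by ring
      _ ≤ starWeight 1 v * (starWeight 1 u * starWeight x (u + 1)) := by gcongr
      _ = _ := by ring

variable [Fintype ι]

/-- The total weight of the sequences of `m` successive merges, where merging two distinct
indices (an ordered pair) of weights `a` and `b` contributes the factor `a * b`. -/
noncomputable def mergeSum : ℕ → (ι → ℝ) → ℝ
  | 0, _ => 1
  | m + 1, w => ∑ i, ∑ j, if i = j then 0 else w i * w j * mergeSum m (merge w i j)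

lemma mergeSum_succ (m : ℕ) (w : ι → ℝ) :
    mergeSum (m + 1) w =
      ∑ i, ∑ j, if i = j then 0 else w i * w j * mergeSum m (merge w i j) := rfl

lemma mergeSum_nonneg (m : ℕ) {w : ι → ℝ} (hw : ∀ k, 0 ≤ w k) : 0 ≤ mergeSum m w := by
  induction m generalizing w with
  | zero => exact zero_le_one
  | succ m ih =>
    refine sum_nonneg fun i _ => sum_nonneg fun j _ => ?_
    split_ifs
    exacts [le_rfl, mul_nonneg (mul_nonneg (hw _) (hw _)) (ih (merge_nonneg hw i j))]

lemma mergeSum_comp_equiv (m : ℕ) (w : ι → ℝ) (σ : Equiv.Perm ι) :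
    mergeSum m (w ∘ σ) = mergeSum m w := by
  induction m generalizing w with
  | zero => rfl
  | succ m ih =>
    rw [eq_comm, mergeSum_succ, mergeSum_succ, ← Equiv.sum_comp σ]
    refine sum_congr rfl fun i _ => ?_
    rw [← Equiv.sum_comp σ]
    refine sum_congr rfl fun j _ => ?_
    have h : merge (w ∘ σ) i j = merge w (σ i) (σ j) ∘ σ := by
      funext k
      simp [merge]
    rw [h, ih]
    simp

lemma mergeSum_merge_comm (m : ℕ) (w : ι → ℝ) {i j : ι} (hij : i ≠ j) :
    mergeSum m (merge w j i) = mergeSum m (merge w i j) := by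
  rw [← mergeSum_comp_equiv m (merge w i j) (Equiv.swap i j)]
  congr 1
  funext k
  by_cases hi : k = i
  · subst hi; simp [merge]
  · by_cases hj : k = j
    · subst hj; simp [merge, hij, hij.symm, add_comm]
    · simp [merge, hi, hj, Equiv.swap_apply_of_ne_of_ne hi hj]

lemma mergeSum_eq_zero (m : ℕ) (w : ι → ℝ) (T : Finset ι) (hw : ∀ k ∉ T, w k = 0)
    (hT : #T ≤ m + 1) : mergeSum (m + 1) w = 0 := by
  induction m generalizing w T with
  | zero =>
    refine sum_eq_zero fun i _ => sum_eq_zero fun j _ => ?_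
    split_ifs with hij
    · rfl
    · by_cases hi : i ∈ T
      · by_cases hj : j ∈ T
        · exact absurd (Finset.card_le_one.mp hT i hi j hj) hij
        · simp [hw j hj]
      · simp [hw i hi]
  | succ m ih =>
    rw [mergeSum_succ]
    refine sum_eq_zero fun i _ => sum_eq_zero fun j _ => ?_
    split_ifs with hij
    · rfl
    · by_cases hi : i ∈ T
      · by_cases hj : j ∈ T
        · rw [ih (merge w i j) (T.erase j), mul_zero]
          · intro k hk
            unfold merge
            split_ifs with h1 h2
            · rfl
            · exact absurd (by subst h2; simp [hij, hi]) hk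
            · exact hw k fun h => hk (by simp [h1, h])
          · rw [card_erase_of_mem hj]; omega
        · simp [hw j hj]
      · simp [hw i hi]

/-- With the sum of two weights fixed, `mergeSum` is affine in their product. -/
lemma exists_mergeSum_setPair (m : ℕ) {p q : ι} (hpq : p ≠ q) (w : ι → ℝ) (s : ℝ) :
    ∃ P Q : ℝ, ∀ x y : ℝ, x + y = s → mergeSum m (setPair w p q x y) = P + Q * (x * y) := by
  induction m generalizing w s with
  | zero => exact ⟨1, 0, fun x y _ => by simp [mergeSum]⟩
  | succ m ih =>
    choose P Q hPQ using ih
    let R : Finset ι := (univ.erase p).erase q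
    have hsum (f : ι → ℝ) : ∑ i, f i = f p + (f q + ∑ i ∈ R, f i) := by
      rw [add_sum_erase _ _ (by simp [hpq.symm]), add_sum_erase _ _ (mem_univ p)]
    let z (j : ι) : ι → ℝ := fun k => if k = j then 0 else w k
    refine ⟨∑ j ∈ R, 2 * s * w j * P (z j) (s + w j) +
        ∑ i ∈ R, ∑ j ∈ R, (if i = j then 0 else w i * w j * P (merge w i j) s),
      2 * P w s + ∑ j ∈ R, 2 * w j * (s + 2 * w j) * Q (z j) (s + w j) +
        ∑ i ∈ R, ∑ j ∈ R, (if i = j then 0 else w i * w j * Q (merge w i j) s), ?_⟩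
    intro x y hxy
    have hR {j : ι} (hj : j ∈ R) : j ≠ p ∧ j ≠ q := by
      simp only [R, mem_erase, mem_univ, and_true] at hj
      exact ⟨hj.2, hj.1⟩
    have vp : setPair w p q x y p = x := by simp [setPair, hpq]
    have vq : setPair w p q x y q = y := by simp [setPair]
    have vj {j : ι} (hj : j ∈ R) : setPair w p q x y j = w j := by simp [setPair, hR hj]
    have epq : mergeSum m (merge (setPair w p q x y) p q) = P w s := by
      have : merge (setPair w p q x y) p q = setPair w p q s 0 := by
        funext k
        simp only [merge, vp, vq, hxy]
        simp only [setPair]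
        split_ifs <;> rfl
      rw [this, hPQ w s s 0 (add_zero s)]
      ring
    have eqp : mergeSum m (merge (setPair w p q x y) q p) = P w s := by
      rw [mergeSum_merge_comm _ _ hpq, epq]
    have epj {j : ι} (hj : j ∈ R) : mergeSum m (merge (setPair w p q x y) p j) =
        P (z j) (s + w j) + Q (z j) (s + w j) * ((x + w j) * y) := by
      have : merge (setPair w p q x y) p j = setPair (z j) p q (x + w j) y := by
        funext k
        simp only [merge, vp, vj hj]
        simp only [setPair, z]
        have := hR hj
        split_ifs <;> grind
      rw [this, hPQ _ (s + w j) _ _ (by rw [← hxy]; ring)]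
    have eqj {j : ι} (hj : j ∈ R) : mergeSum m (merge (setPair w p q x y) q j) =
        P (z j) (s + w j) + Q (z j) (s + w j) * (x * (y + w j)) := by
      have : merge (setPair w p q x y) q j = setPair (z j) p q x (y + w j) := by
        funext k
        simp only [merge, vq, vj hj]
        simp only [setPair, z]
        have := hR hj
        split_ifs <;> grind
      rw [this, hPQ _ (s + w j) _ _ (by rw [← hxy]; ring)]
    have eij {i j : ι} (hi : i ∈ R) (hj : j ∈ R) : mergeSum m (merge (setPair w p q x y) i j) =
        P (merge w i j) s + Q (merge w i j) s * (x * y) := by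
      have : merge (setPair w p q x y) i j = setPair (merge w i j) p q x y := by
        funext k
        simp only [merge, vj hi, vj hj]
        simp only [setPair, merge]
        have := hR hi
        have := hR hj
        split_ifs <;> grind
      rw [this, hPQ _ s _ _ hxy]
    rw [mergeSum_succ, hsum, hsum, hsum]
    have h3 : ∀ i ∈ R, (∑ j, if i = j then 0 else setPair w p q x y i * setPair w p q x y j *
        mergeSum m (merge (setPair w p q x y) i j)) =
        w i * x * (P (z i) (s + w i) + Q (z i) (s + w i) * ((x + w i) * y)) +
        (w i * y * (P (z i) (s + w i) + Q (z i) (s + w i) * (x * (y + w i))) +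
        ∑ j ∈ R, ((if i = j then 0 else w i * w j * P (merge w i j) s) +
          (if i = j then 0 else w i * w j * Q (merge w i j) s) * (x * y))) := by
      intro i hi
      rw [hsum, if_neg (hR hi).1, if_neg (hR hi).2, mergeSum_merge_comm _ _ (hR hi).1.symm,
        mergeSum_merge_comm _ _ (hR hi).2.symm, epj hi, eqj hi, vj hi, vp, vq]
      congr 2
      refine sum_congr rfl fun j hj => ?_
      split_ifs with h
      · simp
      · rw [vj hj, eij hi hj]; ring
    have h1 : ∀ j ∈ R, (if p = j then 0 else setPair w p q x y p * setPair w p q x y j *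
        mergeSum m (merge (setPair w p q x y) p j)) =
        x * w j * (P (z j) (s + w j) + Q (z j) (s + w j) * ((x + w j) * y)) := by
      intro j hj
      rw [if_neg (hR hj).1.symm, vp, vj hj, epj hj]
    have h2 : ∀ j ∈ R, (if q = j then 0 else setPair w p q x y q * setPair w p q x y j *
        mergeSum m (merge (setPair w p q x y) q j)) =
        y * w j * (P (z j) (s + w j) + Q (z j) (s + w j) * (x * (y + w j))) := by
      intro j hj
      rw [if_neg (hR hj).2.symm, vq, vj hj, eqj hj]
    rw [sum_congr rfl h1, sum_congr rfl h2, sum_congr rfl h3, if_pos rfl, if_pos rfl, if_neg hpq,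
      if_neg hpq.symm, epq, eqp, vp, vq]
    simp only [sum_add_distrib, ← sum_mul]
    have e1 : ∑ j ∈ R, 2 * s * w j * P (z j) (s + w j) +
        (∑ j ∈ R, 2 * w j * (s + 2 * w j) * Q (z j) (s + w j)) * (x * y) =
        ∑ j ∈ R, x * w j * (P (z j) (s + w j) + Q (z j) (s + w j) * ((x + w j) * y)) +
        ∑ j ∈ R, y * w j * (P (z j) (s + w j) + Q (z j) (s + w j) * (x * (y + w j))) +
        ∑ j ∈ R, w j * x * (P (z j) (s + w j) + Q (z j) (s + w j) * ((x + w j) * y)) +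
        ∑ j ∈ R, w j * y * (P (z j) (s + w j) + Q (z j) (s + w j) * (x * (y + w j))) := by
      rw [sum_mul, ← sum_add_distrib, ← sum_add_distrib, ← sum_add_distrib, ← sum_add_distrib]
      refine sum_congr rfl fun j _ => ?_
      rw [← hxy]
      ring
    linear_combination -e1

/-- Decomposition of `mergeSum` according to the set of indices merged with `o`. -/
lemma mergeSum_eq_sum_powerset (m : ℕ) (w : ι → ℝ) (o : ι) :
    mergeSum m w = ∑ V ∈ (univ.erase o).powerset,
      (m.descFactorial #V : ℝ) * 2 ^ #V * treeWeight (w o) V w *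
        mergeSum (m - #V) (clear w (insert o V)) := by
  induction m generalizing w with
  | zero =>
    rw [sum_eq_single ∅]
    · simp [mergeSum, treeWeight]
    · intro V _ hV
      obtain ⟨v, hv⟩ := Nat.exists_eq_succ_of_ne_zero (card_ne_zero.mpr (nonempty_iff_ne_empty.mpr hV))
      simp [hv]
    · simp
  | succ m ih =>
    set R : Finset ι := univ.erase o with hR
    have hsum (f : ι → ℝ) : ∑ i, f i = f o + ∑ i ∈ R, f i :=
      (add_sum_erase _ _ (mem_univ o)).symm
    have hRo {j : ι} (hj : j ∈ R) : j ≠ o := by simpa [hR] using hj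
    have hL : mergeSum (m + 1) w = ∑ j ∈ R, (2 * (w o * w j * mergeSum m (merge w o j)) +
        ∑ i ∈ R, if i = j then 0 else w i * w j * mergeSum m (merge w i j)) := by
      rw [mergeSum_succ, hsum, hsum, if_pos rfl, zero_add, sum_add_distrib,
        sum_comm (s := R) (t := R)]
      rw [sum_congr rfl fun i hi => hsum _, sum_add_distrib, ← add_assoc, ← sum_add_distrib]
      congr 1
      refine sum_congr rfl fun j hj => ?_
      rw [if_neg (hRo hj).symm, if_neg (hRo hj), mergeSum_merge_comm _ _ (hRo hj).symm]
      ring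
    let c (V : Finset ι) : ℝ := (m.descFactorial #V : ℝ) * 2 ^ #V
    have hA {j : ι} (hj : j ∈ R) : mergeSum m (merge w o j) =
        ∑ V ∈ R.powerset with j ∉ V, c V * (treeWeight (w o + w j) V w *
          mergeSum (m - #V) (clear w (insert o (insert j V)))) := by
      rw [ih, sum_filter]
      refine sum_congr rfl fun V hV => ?_
      have hoV : o ∉ V := fun h => hRo (mem_powerset.mp hV h) rfl
      have ho : merge w o j o = w o + w j := by simp [merge, (hRo hj).symm]
      by_cases h : j ∈ V
      · rw [treeWeight_eq_zero _ _ h (by simp [merge]), if_neg (not_not.mpr h)]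
        ring
      · rw [ho, treeWeight_congr _ (w' := w), mul_assoc, if_pos h]
        · congr 3
          funext k
          simp only [clear, merge, mem_insert]
          grind
        · intro k hk
          simp only [merge]
          grind
    have hB {i j : ι} (hi : i ∈ R) (hj : j ∈ R) (hij : i ≠ j) : mergeSum m (merge w i j) =
        ∑ V ∈ R.powerset with j ∉ V, c V * (if i ∈ V then
          treeWeight (w o) V (merge w i j) * mergeSum (m - #V) (clear w (insert o (insert j V)))
          else treeWeight (w o) V w * mergeSum (m - #V) (merge (clear w (insert o V)) i j)) := by
      rw [ih, sum_filter]
      refine sum_congr rfl fun V hV => ?_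
      have hoV : o ∉ V := fun h => hRo (mem_powerset.mp hV h) rfl
      have hio := hRo hi
      have hjo := hRo hj
      have ho : merge w i j o = w o := by simp [merge, hjo.symm, hio.symm]
      by_cases hjV : j ∈ V
      · rw [treeWeight_eq_zero _ _ hjV (by simp [merge]), if_neg (not_not.mpr hjV)]
        ring
      rw [ho, if_pos hjV, mul_assoc]
      congr 1
      split_ifs with hiV
      · congr 2
        funext k
        simp only [clear, merge, mem_insert]
        grind
      · rw [treeWeight_congr _ (w' := w)]
        · congr 2
          funext k
          simp only [clear, merge, mem_insert]
          grind
        · intro k hk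
          simp only [merge]
          grind
    let g (j : ι) (V : Finset ι) : ℝ := c V * mergeSum (m - #V) (clear w (insert o (insert j V))) *
      (2 * (w o * w j * treeWeight (w o + w j) V w) +
        ∑ i ∈ V, w i * w j * treeWeight (w o) V (merge w i j))
    let h (j : ι) (V : Finset ι) : ℝ := ∑ i ∈ R \ V, if i = j then 0 else
      w i * w j * (c V * (treeWeight (w o) V w *
        mergeSum (m - #V) (merge (clear w (insert o V)) i j)))
    have hgh : mergeSum (m + 1) w = ∑ j ∈ R, ∑ V ∈ R.powerset with j ∉ V, g j V +
        ∑ j ∈ R, ∑ V ∈ R.powerset with j ∉ V, h j V := by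
      rw [hL, ← sum_add_distrib]
      refine sum_congr rfl fun j hj => ?_
      have hi : ∀ i ∈ R, (if i = j then 0 else w i * w j * mergeSum m (merge w i j)) =
          ∑ V ∈ R.powerset with j ∉ V, if i = j then 0 else w i * w j * (c V * (if i ∈ V then
          treeWeight (w o) V (merge w i j) * mergeSum (m - #V) (clear w (insert o (insert j V)))
          else treeWeight (w o) V w * mergeSum (m - #V) (merge (clear w (insert o V)) i j))) := by
        intro i hi
        split_ifs with hij
        · simp
        · rw [hB hi hj hij, mul_sum]
      rw [sum_congr rfl hi, sum_comm, hA hj, mul_sum, mul_sum, ← sum_add_distrib,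
        ← sum_add_distrib]
      refine sum_congr rfl fun V hV => ?_
      obtain ⟨hVR, hjV⟩ := mem_filter.mp hV
      rw [← sum_sdiff (mem_powerset.mp hVR), add_comm (∑ i ∈ R \ V, _), ← add_assoc]
      congr 1
      · simp only [g]
        rw [mul_add, mul_sum]
        congr 1
        · ring
        · refine sum_congr rfl fun i hi => ?_
          rw [if_neg (fun hij : i = j => hjV (hij ▸ hi)), if_pos hi]
          ring
      · refine sum_congr rfl fun i hi => ?_
        rw [if_neg (mem_sdiff.mp hi).2]
    have hg : ∑ j ∈ R, ∑ V ∈ R.powerset with j ∉ V, g j V = ∑ V ∈ R.powerset,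
        (#V * m.descFactorial (#V - 1) : ℝ) * 2 ^ #V * treeWeight (w o) V w *
          mergeSum (m + 1 - #V) (clear w (insert o V)) := by
      rw [sum_sum_powerset_erase]
      refine sum_congr rfl fun V _ => ?_
      rcases V.eq_empty_or_nonempty with rfl | hne
      · simp
      obtain ⟨v, hv⟩ := Nat.exists_eq_succ_of_ne_zero hne.card_ne_zero
      have hj : ∀ j ∈ V, g j (V.erase j) = (m.descFactorial v : ℝ) * 2 ^ v *
          mergeSum (m - v) (clear w (insert o V)) *
          (2 * (w o * w j * treeWeight (w o + w j) (V.erase j) w) +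
            ∑ i ∈ V.erase j, w i * w j * treeWeight (w o) (V.erase j) (merge w i j)) := by
        intro j hj
        simp only [g, c, insert_erase hj, card_erase_of_mem hj, hv, Nat.succ_sub_one]
      rw [sum_congr rfl hj, ← mul_sum, ← treeWeight_contract, hv]
      simp only [Nat.succ_eq_add_one, Nat.add_sub_cancel, Nat.add_sub_add_right, pow_succ]
      ring
    have hh : ∑ j ∈ R, ∑ V ∈ R.powerset with j ∉ V, h j V = ∑ V ∈ R.powerset,
        (m.descFactorial #V : ℝ) * 2 ^ #V * treeWeight (w o) V w *
          mergeSum (m + 1 - #V) (clear w (insert o V)) := by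
      simp only [sum_filter]
      rw [sum_comm]
      refine sum_congr rfl fun V hV => ?_
      rcases lt_or_ge m #V with hm | hm
      · simp [h, c, Nat.descFactorial_of_lt hm]
      have hz : ∀ k ∈ univ \ (R \ V), clear w (insert o V) k = 0 := by
        intro k hk
        simp only [hR, mem_sdiff, mem_univ, mem_erase, true_and, and_true] at hk
        simp only [clear, mem_insert]
        grind
      have hnz : ∀ k ∈ R \ V, clear w (insert o V) k = w k := by
        intro k hk
        simp only [hR, mem_sdiff, mem_univ, mem_erase, and_true] at hk
        simp [clear, hk]
      rw [Nat.succ_sub hm, mergeSum_succ, sum_comm, mul_sum, ← sum_filter, filter_notMem_eq_sdiff]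
      refine sum_subset_zero_on_sdiff (subset_univ _) (fun j hj => ?_) (fun j hj => ?_)
      · simp [hz j hj]
      · rw [mul_sum]
        refine sum_subset_zero_on_sdiff (subset_univ _) (fun i hi => ?_) (fun i hi => ?_)
        · simp [hz i hi]
        · simp only [hnz j hj, hnz i hi, c]
          split_ifs <;> ring
    rw [hgh, hg, hh, ← sum_add_distrib]
    refine sum_congr rfl fun V _ => ?_
    rw [descFactorial_succ_left]
    push_cast
    ring

/-- The weighted form of Cayley's formula. -/
lemma mergeSum_card_sub_one (S : Finset ι) (w : ι → ℝ) (hw : ∀ k ∉ S, w k = 0) {o : ι}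
    (ho : o ∈ S) : mergeSum (#S - 1) w =
      ((#S - 1).factorial : ℝ) * 2 ^ (#S - 1) * treeWeight (w o) (S.erase o) w := by
  have hc : #(S.erase o) = #S - 1 := card_erase_of_mem ho
  rw [mergeSum_eq_sum_powerset _ w o, sum_eq_single (S.erase o)]
  · rw [hc, Nat.descFactorial_self, Nat.sub_self]
    simp [mergeSum]
  · intro V hV hne
    by_cases hVS : V ⊆ S.erase o
    · have hlt : #V < #S - 1 := hc ▸ card_lt_card (hVS.ssubset_of_ne hne)
      obtain ⟨d, hd⟩ : ∃ d, #S - 1 - #V = d + 1 := ⟨#S - 1 - #V - 1, by omega⟩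
      have hins : insert o V ⊆ S := insert_subset ho (hVS.trans (erase_subset _ _))
      have hoV : o ∉ V := fun h => notMem_erase o S (hVS h)
      rw [hd, mergeSum_eq_zero d _ (S \ insert o V), mul_zero]
      · intro k hk
        simp only [clear]
        split_ifs with h
        · rfl
        · exact hw k fun hkS => hk (mem_sdiff.mpr ⟨hkS, h⟩)
      · rw [card_sdiff_of_subset hins, card_insert_of_notMem hoV]
        omega
    · obtain ⟨j, hj, hjS⟩ := not_subset.mp hVS
      have hjo : j ≠ o := (mem_erase.mp (mem_powerset.mp hV hj)).1
      rw [treeWeight_eq_zero _ _ hj (hw j fun h => hjS (mem_erase.mpr ⟨hjo, h⟩))]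
      ring
  · intro h
    exact absurd (mem_powerset.mpr (erase_subset_erase o (subset_univ S))) h

lemma mergeSum_card_sub_one_pos {S : Finset ι} (hS : S.Nonempty) {w : ι → ℝ}
    (hw : ∀ k ∉ S, w k = 0) (hw' : ∀ k ∈ S, 0 < w k) : 0 < mergeSum (#S - 1) w := by
  obtain ⟨o, ho⟩ := hS
  have hT : 0 < treeWeight (w o) (S.erase o) w := by
    unfold treeWeight
    split_ifs
    · exact one_pos
    · have h1 := hw' o ho
      have h2 : 0 < ∏ k ∈ S.erase o, w k := prod_pos fun k hk => hw' k (mem_of_mem_erase hk)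
      have h3 : 0 ≤ ∑ k ∈ S.erase o, w k := sum_nonneg fun k hk => (hw' k (mem_of_mem_erase hk)).le
      positivity
  rw [mergeSum_card_sub_one S w hw ho]
  positivity

/-- The weight vector with weight one on `S` and zero elsewhere. -/
def indicatorWeight (S : Finset ι) : ι → ℝ := fun k => if k ∈ S then 1 else 0

lemma mergeSum_mul_le_of_eq_one (m : ℕ) {S : Finset ι} {w : ι → ℝ} (hw : ∀ k ∉ S, w k = 0)
    {o : ι} (ho : o ∈ S) (hwo : 1 ≤ w o) (hw1 : ∀ k ∈ S.erase o, w k = 1) :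
    mergeSum m w * mergeSum (#S - 1) (indicatorWeight S) ≤
      mergeSum m (indicatorWeight S) * mergeSum (#S - 1) w := by
  have hi : ∀ k ∉ S, indicatorWeight S k = 0 := fun k hk => if_neg hk
  have hi1 : ∀ k ∈ S, indicatorWeight S k = 1 := fun k hk => if_pos hk
  have hi1' : ∀ k ∈ S.erase o, indicatorWeight S k = 1 := fun k hk => hi1 k (mem_of_mem_erase hk)
  have hi0 (k : ι) : 0 ≤ indicatorWeight S k := by
    unfold indicatorWeight
    split_ifs <;> norm_num
  rw [mergeSum_card_sub_one S w hw ho, mergeSum_card_sub_one S _ hi ho,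
    treeWeight_eq_starWeight _ hw1, treeWeight_eq_starWeight _ hi1', hi1 o ho,
    mergeSum_eq_sum_powerset m w o, mergeSum_eq_sum_powerset m (indicatorWeight S) o, sum_mul,
    sum_mul]
  refine sum_le_sum fun V hV => ?_
  have hclear : clear w (insert o V) = clear (indicatorWeight S) (insert o V) := by
    funext k
    simp only [clear]
    split_ifs with h
    · rfl
    · by_cases hk : k ∈ S
      · rw [hi1 k hk, hw1 k (mem_erase.mpr ⟨fun hko => h (hko ▸ mem_insert_self _ _), hk⟩)]
      · rw [hi k hk, hw k hk]
  by_cases hVS : V ⊆ S.erase o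
  · have key := starWeight_mul_le hwo (card_le_card hVS)
    rw [hclear, treeWeight_eq_starWeight _ fun k hk => hw1 k (hVS hk),
      treeWeight_eq_starWeight _ fun k hk => hi1' k (hVS hk), hi1 o ho]
    have hM : 0 ≤ mergeSum (m - #V) (clear (indicatorWeight S) (insert o V)) := by
      refine mergeSum_nonneg _ fun k => ?_
      simp only [clear]
      split_ifs
      exacts [le_rfl, hi0 k]
    calc _ = ((m.descFactorial #V : ℝ) * 2 ^ #V *
          mergeSum (m - #V) (clear (indicatorWeight S) (insert o V)) *
          (((#S - 1).factorial : ℝ) * 2 ^ (#S - 1))) *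
          (starWeight (w o) #V * starWeight 1 #(S.erase o)) := by ring
      _ ≤ ((m.descFactorial #V : ℝ) * 2 ^ #V *
          mergeSum (m - #V) (clear (indicatorWeight S) (insert o V)) *
          (((#S - 1).factorial : ℝ) * 2 ^ (#S - 1))) *
          (starWeight 1 #V * starWeight (w o) #(S.erase o)) := by gcongr
      _ = _ := by ring
  · obtain ⟨j, hj, hjS⟩ := not_subset.mp hVS
    have hjo : j ≠ o := (mem_erase.mp (mem_powerset.mp hV hj)).1
    have hjS' : j ∉ S := fun h => hjS (mem_erase.mpr ⟨hjo, h⟩)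
    rw [treeWeight_eq_zero _ _ hj (hw j hjS'), treeWeight_eq_zero _ _ hj (hi j hjS')]
    simp

lemma mergeSum_mul_le_setPair (m : ℕ) {S : Finset ι} {w : ι → ℝ} (hw : ∀ k ∉ S, w k = 0)
    (hw1 : ∀ k ∈ S, 1 ≤ w k) {o i : ι} (ho : o ∈ S) (hi : i ∈ S) (hoi : o ≠ i) :
    mergeSum m w * mergeSum (#S - 1) (setPair w o i (w o + w i - 1) 1) ≤
      mergeSum m (setPair w o i (w o + w i - 1) 1) * mergeSum (#S - 1) w := by
  have hself : setPair w o i (w o) (w i) = w := by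
    funext k
    simp only [setPair]
    split_ifs with h1 h2
    exacts [h1 ▸ rfl, h2 ▸ rfl, rfl]
  have hcard : 1 < #S := one_lt_card.mpr ⟨o, ho, i, hi, hoi⟩
  obtain ⟨d, hd⟩ : ∃ d, #S - 1 = d + 1 := ⟨#S - 2, by omega⟩
  have hwo := hw1 o ho
  have hwi := hw1 i hi
  have hw0 (k : ι) : 0 ≤ w k := by
    by_cases hk : k ∈ S
    · exact zero_le_one.trans (hw1 k hk)
    · exact (hw k hk).ge
  obtain ⟨P, Q, hPQ⟩ := exists_mergeSum_setPair m hoi w (w o + w i)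
  obtain ⟨P', Q', hPQ'⟩ := exists_mergeSum_setPair (#S - 1) hoi w (w o + w i)
  have hP : 0 ≤ P := by
    have h := hPQ (w o + w i) 0 (add_zero _)
    rw [mul_zero, mul_zero, add_zero] at h
    rw [← h]
    refine mergeSum_nonneg _ fun k => ?_
    simp only [setPair]
    split_ifs
    exacts [le_rfl, add_nonneg (hw0 o) (hw0 i), hw0 k]
  have hP' : P' = 0 := by
    have h := hPQ' (w o + w i) 0 (add_zero _)
    rw [mul_zero, mul_zero, add_zero] at h
    rw [← h, hd]
    refine mergeSum_eq_zero d _ (S.erase i) (fun k hk => ?_) ?_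
    · simp only [setPair]
      split_ifs with h1 h2
      · rfl
      · exact absurd (mem_erase.mpr ⟨h1, h2 ▸ ho⟩) hk
      · exact hw k fun h => hk (mem_erase.mpr ⟨h1, h⟩)
    · rw [card_erase_of_mem hi]
      omega
  have e1 := hPQ (w o) (w i) rfl
  have e2 := hPQ (w o + w i - 1) 1 (by ring)
  have e3 := hPQ' (w o) (w i) rfl
  have e4 := hPQ' (w o + w i - 1) 1 (by ring)
  rw [hself] at e1 e3
  have hQ' : 0 ≤ Q' := by
    have h := mergeSum_nonneg (#S - 1) hw0
    rw [e3, hP', zero_add] at h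
    exact nonneg_of_mul_nonneg_left h (by positivity)
  rw [e1, e2, e3, e4, hP']
  nlinarith [mul_nonneg (mul_nonneg hP hQ') (mul_nonneg (sub_nonneg.mpr hwo) (sub_nonneg.mpr hwi))]

/-- Among the weight vectors supported on `S` with weights at least one there, the ratio of
`mergeSum m` to `mergeSum (#S - 1)` is largest when all the weights are one. -/
lemma mergeSum_mul_le (m : ℕ) {S : Finset ι} (hS : S.Nonempty) {w : ι → ℝ}
    (hw : ∀ k ∉ S, w k = 0) (hw1 : ∀ k ∈ S, 1 ≤ w k) :
    mergeSum m w * mergeSum (#S - 1) (indicatorWeight S) ≤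
      mergeSum m (indicatorWeight S) * mergeSum (#S - 1) w := by
  obtain ⟨o, ho⟩ := hS
  induction hN : #{i ∈ S.erase o | w i ≠ 1} using Nat.strong_induction_on generalizing w with
  | _ N ih =>
    by_cases hall : ∀ k ∈ S.erase o, w k = 1
    · exact mergeSum_mul_le_of_eq_one m hw ho (hw1 o ho) hall
    push Not at hall
    obtain ⟨i, hi, hi1⟩ := hall
    obtain ⟨hio, hiS⟩ := mem_erase.mp hi
    have hstep := mergeSum_mul_le_setPair m hw hw1 ho hiS hio.symm
    set w' := setPair w o i (w o + w i - 1) 1 with hw'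
    have hw'0 : ∀ k ∉ S, w' k = 0 := by
      intro k hk
      have h1 : k ≠ i := fun h => hk (h ▸ hiS)
      have h2 : k ≠ o := fun h => hk (h ▸ ho)
      simp [hw', setPair, h1, h2, hw k hk]
    have hw'1 : ∀ k ∈ S, 1 ≤ w' k := by
      intro k hk
      simp only [hw', setPair]
      split_ifs
      · exact le_rfl
      · linarith [hw1 o ho, hw1 i hiS]
      · exact hw1 k hk
    have hlt : #{j ∈ S.erase o | w' j ≠ 1} < N := by
      rw [← hN]
      refine card_lt_card ⟨fun j hj => ?_, fun h => ?_⟩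
      · obtain ⟨hj, hj1⟩ := mem_filter.mp hj
        refine mem_filter.mpr ⟨hj, fun h1 => hj1 ?_⟩
        simp only [hw', setPair, if_neg (mem_erase.mp hj).1]
        split_ifs
        exacts [rfl, h1]
      · have := (mem_filter.mp (h (mem_filter.mpr ⟨hi, hi1⟩))).2
        simp [hw', setPair] at this
    have hind := ih _ hlt hw'0 hw'1 rfl
    have hpos : 0 < mergeSum (#S - 1) w' :=
      mergeSum_card_sub_one_pos ⟨o, ho⟩ hw'0 fun k hk => one_pos.trans_le (hw'1 k hk)
    have hposw : 0 < mergeSum (#S - 1) w :=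
      mergeSum_card_sub_one_pos ⟨o, ho⟩ hw fun k hk => one_pos.trans_le (hw1 k hk)
    have hpos1 : 0 < mergeSum (#S - 1) (indicatorWeight S) :=
      mergeSum_card_sub_one_pos ⟨o, ho⟩ (fun k hk => if_neg hk)
        fun k hk => by simp [indicatorWeight, hk]
    refine le_of_mul_le_mul_right ?_ hpos
    calc _ = mergeSum m w * mergeSum (#S - 1) w' * mergeSum (#S - 1) (indicatorWeight S) := by ring
      _ ≤ mergeSum m w' * mergeSum (#S - 1) w * mergeSum (#S - 1) (indicatorWeight S) := by gcongr
      _ = mergeSum m w' * mergeSum (#S - 1) (indicatorWeight S) * mergeSum (#S - 1) w := by ring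
      _ ≤ mergeSum m (indicatorWeight S) * mergeSum (#S - 1) w' * mergeSum (#S - 1) w := by gcongr
      _ = _ := by ring

lemma sum_merge (w : ι → ℝ) {i j : ι} (hij : i ≠ j) : ∑ k, merge w i j k = ∑ k, w k := by
  have hi : i ∈ univ.erase j := mem_erase.mpr ⟨hij, mem_univ i⟩
  have hm : ∀ k ∈ (univ.erase j).erase i, merge w i j k = w k := by
    intro k hk
    simp only [mem_erase] at hk
    simp [merge, hk]
  rw [← add_sum_erase univ w (mem_univ j), ← add_sum_erase _ w hi,
    ← add_sum_erase univ (merge w i j) (mem_univ j), ← add_sum_erase _ (merge w i j) hi,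
    sum_congr rfl hm]
  simp only [merge, if_true, if_neg hij]
  ring

lemma le_mergeSum_one {S : Finset ι} {w : ι → ℝ} (hw : ∀ k ∉ S, w k = 0)
    (hw1 : ∀ k ∈ S, 1 ≤ w k) :
    ((#S : ℝ) - 1) * (2 * ∑ k, w k - #S) ≤ mergeSum 1 w := by
  have hW : ∑ k, w k = ∑ k ∈ S, w k := (sum_subset (subset_univ S) fun k _ hk => hw k hk).symm
  have h1 : mergeSum 1 w = ∑ i ∈ S, ∑ j ∈ S.erase i, w i * w j := by
    rw [mergeSum_succ]
    refine (sum_subset_zero_on_sdiff (subset_univ _) (fun i hi => ?_) (fun i hi => ?_)).symm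
    · simp [hw i (by simpa using hi)]
    · refine sum_subset_zero_on_sdiff (subset_univ _) (fun j hj => ?_) (fun j hj => ?_)
      · simp only [mem_sdiff, mem_univ, mem_erase, true_and, not_and] at hj
        split_ifs with hij
        · rfl
        · simp [hw j (hj fun h => hij h.symm)]
      · simp [(mem_erase.mp hj).1.symm, mergeSum]
  have h2 : ∑ i ∈ S, ∑ j ∈ S.erase i, (w i + w j - 1) =
      ((#S : ℝ) - 1) * (2 * ∑ k, w k - #S) := by
    have h3 : ∀ i ∈ S, ∑ j ∈ S.erase i, (w i + w j - 1) =
        ((#S : ℝ) - 2) * w i + (∑ k ∈ S, w k - (#S - 1)) := by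
      intro i hi
      rw [sum_sub_distrib, sum_add_distrib, sum_const, sum_const, nsmul_eq_mul, nsmul_eq_mul,
        cast_card_erase_of_mem hi, ← add_sum_erase S w hi]
      ring
    rw [sum_congr rfl h3, sum_add_distrib, ← mul_sum, sum_const, nsmul_eq_mul, hW]
    ring
  rw [h1, ← h2]
  refine sum_le_sum fun i hi => sum_le_sum fun j hj => ?_
  nlinarith [hw1 i hi, hw1 j (mem_of_mem_erase hj)]

lemma le_mergeSum_succ (m : ℕ) {S : Finset ι} {w : ι → ℝ} (hw : ∀ k ∉ S, w k = 0)
    (hw1 : ∀ k ∈ S, 1 ≤ w k) :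
    ((#S : ℝ) - m - 1) * (2 * ∑ k, w k - (#S - m)) * mergeSum m w ≤ mergeSum (m + 1) w := by
  induction m generalizing S w with
  | zero => simpa [mergeSum] using le_mergeSum_one hw hw1
  | succ m ih =>
    rw [mergeSum_succ, mergeSum_succ (m + 1), mul_sum]
    refine sum_le_sum fun i _ => ?_
    rw [mul_sum]
    refine sum_le_sum fun j _ => ?_
    split_ifs with hij
    · simp
    · by_cases hi : i ∈ S
      · by_cases hj : j ∈ S
        · have h := ih (merge_eq_zero_of_notMem hw hi j) (one_le_merge hw1 hi hj)
          rw [sum_merge w hij, cast_card_erase_of_mem hj] at h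
          have hwi := hw1 i hi
          have hwj := hw1 j hj
          push_cast
          calc _ = w i * w j * (((#S : ℝ) - 1 - m - 1) * (2 * ∑ k, w k - (#S - 1 - m)) *
                mergeSum m (merge w i j)) := by ring
            _ ≤ _ := by gcongr
        · simp [hw j hj]
      · simp [hw i hi]

/-- The total weight of the sets of `m` merges. -/
noncomputable def mergeCount (m : ℕ) (w : ι → ℝ) : ℝ := mergeSum m w / (2 ^ m * m.factorial)

lemma div_le_div_mul_of_mul_le {a b p f M K s W : ℝ} (hp : 0 < p) (hf : 0 < f) (hM : 0 < M)
    (hK : 0 < K) (hW : 0 < W) (h : W * K * a * (2 * M) ≤ s * b) :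
    a / (p * f) ≤ b / (p * 2 * (M * f)) * (s / W / K) := by
  have e : b / (p * 2 * (M * f)) * (s / W / K) - a / (p * f) =
      (s * b - W * K * a * (2 * M)) / (p * 2 * (M * f) * W * K) := by
    field_simp
  have : 0 ≤ (s * b - W * K * a * (2 * M)) / (p * 2 * (M * f) * W * K) :=
    div_nonneg (sub_nonneg.mpr h) (by positivity)
  linarith

lemma mergeCount_le (w : ι → ℝ) {S : Finset ι} (hw : ∀ k ∉ S, w k = 0) (hw1 : ∀ k ∈ S, 1 ≤ w k)
    (k : ℕ) (hk : k < #S) :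
    mergeCount (#S - 1 - k) w ≤
      mergeCount (#S - 1) w * ((#S / ∑ i, w i) ^ k / k.factorial) := by
  have hW : (#S : ℝ) ≤ ∑ i, w i := by
    rw [← sum_subset (subset_univ S) fun k _ hk => hw k hk]
    simpa using sum_le_sum hw1
  obtain ⟨W, hWdef⟩ : ∃ W, W = ∑ i, w i := ⟨_, rfl⟩
  rw [← hWdef] at hW ⊢
  have hw0 (k : ι) : 0 ≤ w k := by
    by_cases hk : k ∈ S
    · exact zero_le_one.trans (hw1 k hk)
    · exact (hw k hk).ge
  induction k with
  | zero => simp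
  | succ k ih =>
    have ih := ih (by omega)
    obtain ⟨m, hm⟩ : ∃ m, #S = m + k + 2 := ⟨#S - k - 2, by omega⟩
    have hm1 : #S - 1 - (k + 1) = m := by omega
    have hm2 : #S - 1 - k = m + 1 := by omega
    have hcast : (#S : ℝ) = m + k + 2 := by rw [hm]; push_cast; ring
    rw [hm2] at ih
    rw [hm1]
    have h := le_mergeSum_succ m hw hw1
    have hT : 0 ≤ mergeSum m w := mergeSum_nonneg m hw0
    have hT' : 0 ≤ mergeSum (m + 1) w := mergeSum_nonneg _ hw0
    have hWpos : 0 < W := by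
      have : (0 : ℝ) < #S := by rw [hcast]; positivity
      linarith
    have hstep : mergeCount m w ≤ mergeCount (m + 1) w * (#S / W / (k + 1)) := by
      rw [← hWdef] at h
      have hm0 : (0 : ℝ) ≤ m := Nat.cast_nonneg m
      have hk0 : (0 : ℝ) ≤ k := Nat.cast_nonneg k
      have e1 : (#S : ℝ) - m - 1 = k + 1 := by rw [hcast]; ring
      have e2 : (#S : ℝ) - m = k + 2 := by rw [hcast]; ring
      rw [e1, e2] at h
      have hpos : 0 < 2 * W - (k + 2) := by linarith
      have hcoef : 2 * W * (m + 1) ≤ #S * (2 * W - (k + 2)) := by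
        rw [hcast] at hW ⊢
        nlinarith
      have hfin : W * (k + 1) * mergeSum m w * (2 * (m + 1)) ≤ #S * mergeSum (m + 1) w := by
        refine le_of_mul_le_mul_right ?_ hpos
        calc _ = 2 * W * (m + 1) * ((k + 1) * (2 * W - (k + 2)) * mergeSum m w) := by ring
          _ ≤ 2 * W * (m + 1) * mergeSum (m + 1) w := by gcongr
          _ ≤ #S * (2 * W - (k + 2)) * mergeSum (m + 1) w := by gcongr
          _ = _ := by ring
      simp only [mergeCount, Nat.factorial_succ, pow_succ]
      push_cast
      exact div_le_div_mul_of_mul_le (by positivity) (by positivity) (by positivity)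
        (by positivity) hWpos hfin
    calc mergeCount m w ≤ mergeCount (m + 1) w * (#S / W / (k + 1)) := hstep
      _ ≤ mergeCount (#S - 1) w * ((#S / W) ^ k / k.factorial) * (#S / W / (k + 1)) :=
        mul_le_mul_of_nonneg_right ih
          (div_nonneg (div_nonneg (Nat.cast_nonneg _) hWpos.le) (by positivity))
      _ = _ := by
        rw [Nat.factorial_succ, pow_succ, Nat.cast_mul, Nat.cast_succ, mul_assoc,
          div_mul_div_comm, mul_comm (k.factorial : ℝ)]

lemma sum_mergeCount_le_exp {w : ι → ℝ} {S : Finset ι} (hw : ∀ k ∉ S, w k = 0)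
    (hw1 : ∀ k ∈ S, 1 ≤ w k) :
    ∑ m ∈ range #S, mergeCount m w ≤
      mergeCount (#S - 1) w * Real.exp (#S / ∑ i, w i) := by
  have hw0 (k : ι) : 0 ≤ w k := by
    by_cases hk : k ∈ S
    · exact zero_le_one.trans (hw1 k hk)
    · exact (hw k hk).ge
  have hT : 0 ≤ mergeCount (#S - 1) w := div_nonneg (mergeSum_nonneg _ hw0) (by positivity)
  have hW : 0 ≤ ∑ i, w i := sum_nonneg fun i _ => hw0 i
  rw [← sum_range_reflect]
  calc _ ≤ ∑ k ∈ range #S, mergeCount (#S - 1) w * ((#S / ∑ i, w i) ^ k / k.factorial) :=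
        sum_le_sum fun k hk => mergeCount_le w hw hw1 k (mem_range.mp hk)
    _ ≤ _ := by
      rw [← mul_sum]
      gcongr
      exact Real.sum_le_exp_of_nonneg (by positivity) _

lemma sum_mergeCount_mul_le {S : Finset ι} (hS : S.Nonempty) {w : ι → ℝ}
    (hw : ∀ k ∉ S, w k = 0) (hw1 : ∀ k ∈ S, 1 ≤ w k) :
    (∑ m ∈ range #S, mergeCount m w) * mergeCount (#S - 1) (indicatorWeight S) ≤
      (∑ m ∈ range #S, mergeCount m (indicatorWeight S)) * mergeCount (#S - 1) w := by
  rw [sum_mul, sum_mul]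
  refine sum_le_sum fun m _ => ?_
  simp only [mergeCount, div_mul_div_comm]
  exact div_le_div_of_nonneg_right (mergeSum_mul_le m hS hw hw1) (by positivity)

end Weights

section BridgeExtensions

open SimpleGraph

variable {V : Type*} {G H : SimpleGraph V}

/-- A bridge of `H` remains a bridge on adding edges that are bridges of the resulting graph. -/
lemma isBridge_of_isBridge_of_forall_isBridge (hle : H ≤ G)
    (hb : ∀ e ∈ G.edgeSet \ H.edgeSet, G.IsBridge e) {e : Sym2 V} (he : e ∈ H.edgeSet)
    (heb : H.IsBridge e) : G.IsBridge e := by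
  rw [isBridge_iff_forall_cycle_notMem (edgeSet_mono hle he)]
  intro u p hp hep
  have hpH : ∀ f ∈ p.edges, f ∈ H.edgeSet := fun f hf => by
    by_contra hfH
    exact (hb f ⟨p.edges_subset_edgeSet hf, hfH⟩).notMem_edges_of_isCycle hp hf
  exact heb.notMem_edges_of_isCycle (hp.transfer hpH) (by rwa [Walk.edges_transfer])

/-- The graphs obtained from `H` by adding edges that are bridges of the resulting graph. -/
def bridgeClass (H : SimpleGraph V) : Set (SimpleGraph V) :=
  {G | H ≤ G ∧ ∀ e ∈ G.edgeSet \ H.edgeSet, G.IsBridge e}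

/-- The graphs obtained from `H` by adding `m` edges that are bridges of the resulting graph. -/
def bridgeExt (H : SimpleGraph V) (m : ℕ) : Set (SimpleGraph V) :=
  {G ∈ bridgeClass H | (G.edgeSet \ H.edgeSet).ncard = m}

lemma edgeSet_sdiff_sup_edge {a b : V} (hab : a ≠ b) :
    G.edgeSet \ (H ⊔ edge a b).edgeSet = (G.edgeSet \ H.edgeSet) \ {s(a, b)} := by
  rw [edgeSet_sup, edgeSet_edge_of_ne hab, Set.sdiff_sdiff]

lemma mem_bridgeExt_succ_iff [Finite V] (m : ℕ) (a b : V) :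
    (G ∈ bridgeExt H (m + 1) ∧ s(a, b) ∈ G.edgeSet \ H.edgeSet) ↔
      ¬ H.Reachable a b ∧ G ∈ bridgeExt (H ⊔ edge a b) m := by
  constructor
  · rintro ⟨⟨⟨hle, hb⟩, hcard⟩, hab⟩
    have hne : a ≠ b := G.ne_of_adj hab.1
    refine ⟨fun hr => hb _ hab (hr.mono ?_), ⟨sup_le hle ?_, ?_⟩, ?_⟩
    · intro x y hxy
      rw [deleteEdges_adj]
      refine ⟨hle hxy, fun h => hab.2 ?_⟩
      rw [← Set.mem_singleton_iff.mp h]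
      exact hxy
    · exact (edge_le_iff G).mpr (Or.inr hab.1)
    · rw [edgeSet_sdiff_sup_edge hne]
      exact fun e he => hb e he.1
    · rw [edgeSet_sdiff_sup_edge hne, Set.ncard_sdiff_singleton_of_mem hab, hcard, Nat.add_sub_cancel]
  · rintro ⟨hr, ⟨hle, hb⟩, hcard⟩
    have hne : a ≠ b := fun h => hr (h ▸ Reachable.refl a)
    have habH : s(a, b) ∉ H.edgeSet := fun h => hr (Adj.reachable h)
    have habH' : s(a, b) ∈ (H ⊔ edge a b).edgeSet := by
      rw [edgeSet_sup, edgeSet_edge_of_ne hne]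
      exact Or.inr rfl
    have hab : s(a, b) ∈ G.edgeSet \ H.edgeSet := ⟨edgeSet_mono hle habH', habH⟩
    refine ⟨⟨⟨le_sup_left.trans hle, fun e he => ?_⟩, ?_⟩, hab⟩
    · by_cases h : e = s(a, b)
      · rw [h]
        exact isBridge_of_isBridge_of_forall_isBridge hle hb habH'
          (isBridge_sup_edge.mpr (IsBridge.of_not_reachable hr))
      · refine hb e ?_
        rw [edgeSet_sdiff_sup_edge hne]
        exact ⟨he, h⟩
    · rw [edgeSet_sdiff_sup_edge hne] at hcard
      rw [← Set.ncard_sdiff_singleton_add_one hab, hcard]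

lemma bridgeExt_zero [Finite V] (H : SimpleGraph V) : bridgeExt H 0 = {H} := by
  ext G
  simp only [bridgeExt, bridgeClass, Set.mem_ofPred_eq, Set.mem_singleton_iff]
  constructor
  · rintro ⟨⟨hle, -⟩, hcard⟩
    rw [Set.ncard_eq_zero, Set.sdiff_eq_empty] at hcard
    exact le_antisymm (edgeSet_subset_edgeSet.mp hcard) hle
  · rintro rfl
    simp

lemma exists_mem_bridgeExt_sup_edge [Finite V] {m : ℕ} (hG : G ∈ bridgeExt H (m + 1)) :
    ∃ a b, ¬ H.Reachable a b ∧ G ∈ bridgeExt (H ⊔ edge a b) m := by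
  have hne : (G.edgeSet \ H.edgeSet).Nonempty := by
    rw [← Set.ncard_pos, hG.2]
    exact m.succ_pos
  obtain ⟨e, he⟩ := hne
  induction e with
  | h a b => exact ⟨a, b, (mem_bridgeExt_succ_iff m a b).mp ⟨hG, he⟩⟩

section Labels

variable {ι : Type*} [DecidableEq ι]

/-- The labelling obtained from `c` by giving the vertices labelled `j` the label `i`. -/
def collapse (c : V → ι) (i j : ι) : V → ι := fun v => if c v = j then i else c v

lemma collapse_eq_iff {c : V → ι} (hc : ∀ x y, c x = c y ↔ H.Reachable x y) (a b x y : V) :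
    collapse c (c a) (c b) x = collapse c (c a) (c b) y ↔ (H ⊔ edge a b).Reachable x y := by
  have hab : (H ⊔ edge a b).Reachable a b := by
    by_cases h : a = b
    · exact h ▸ Reachable.refl a
    · exact Adj.reachable (Or.inr ((edge_adj a b a b).mpr ⟨Or.inl ⟨rfl, rfl⟩, h⟩))
  have hH {u v : V} (h : c u = c v) : (H ⊔ edge a b).Reachable u v :=
    ((hc u v).mp h).mono le_sup_left
  constructor
  · intro h
    simp only [collapse] at h
    split_ifs at h with h1 h2 h2
    · exact hH (h1.trans h2.symm)
    · exact (hH h1).trans (hab.symm.trans (hH h))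
    · exact (hH h).trans (hab.trans (hH h2.symm))
    · exact hH h
  · rintro ⟨p⟩
    induction p with
    | nil => rfl
    | cons hadj _ ih =>
      refine Eq.trans ?_ ih
      rcases hadj with h | h
      · simp only [collapse, (hc _ _).mpr h.reachable]
      · rcases ((edge_adj a b _ _).mp h).1 with ⟨rfl, rfl⟩ | ⟨rfl, rfl⟩ <;> simp [collapse]

variable [Fintype V]

/-- The number of vertices with a given label. -/
def labelWeight (c : V → ι) : ι → ℝ := fun i => #{v | c v = i}

lemma labelWeight_collapse (c : V → ι) {i j : ι} (hij : i ≠ j) :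
    labelWeight (collapse c i j) = merge (labelWeight c) i j := by
  classical
  funext k
  simp only [labelWeight, merge]
  split_ifs with h1 h2
  · rw [Nat.cast_eq_zero, card_eq_zero, filter_eq_empty_iff]
    intro v _
    simp only [collapse]
    split_ifs with h
    · exact h1 ▸ hij
    · exact h1 ▸ h
  · subst h2
    rw [← Nat.cast_add, ← card_union_of_disjoint, ← filter_or]
    · congr 2
      ext v
      simp only [collapse]
      grind
    · rw [disjoint_filter]
      exact fun v _ h h' => hij (h.symm.trans h')
  · congr 2
    ext v
    simp only [collapse]
    grind

lemma labelWeight_eq_zero (c : V → ι) : ∀ k ∉ univ.image c, labelWeight c k = 0 := by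
  intro k hk
  rw [labelWeight, Nat.cast_eq_zero, card_eq_zero, filter_eq_empty_iff]
  exact fun v _ h => hk (mem_image.mpr ⟨v, mem_univ v, h⟩)

lemma one_le_labelWeight (c : V → ι) : ∀ k ∈ univ.image c, 1 ≤ labelWeight c k := by
  intro k hk
  obtain ⟨v, -, hv⟩ := mem_image.mp hk
  rw [labelWeight, Nat.one_le_cast, Nat.one_le_iff_ne_zero]
  exact card_ne_zero_of_mem (mem_filter.mpr ⟨mem_univ v, hv⟩)

lemma labelWeight_of_injective {c : V → ι} (hc : Injective c) :
    labelWeight c = indicatorWeight (univ.image c) := by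
  funext k
  by_cases hk : k ∈ univ.image c
  · obtain ⟨v, -, rfl⟩ := mem_image.mp hk
    have : ({u | c u = c v} : Finset V) = {v} := by
      ext u
      simp [hc.eq_iff]
    simp [indicatorWeight, labelWeight, this]
  · rw [labelWeight_eq_zero c k hk, indicatorWeight, if_neg hk]

lemma exists_label_of_mem_bridgeExt {m : ℕ} {c : V → ι}
    (hc : ∀ x y, c x = c y ↔ H.Reachable x y) (hG : G ∈ bridgeExt H m) :
    ∃ c' : V → ι, (∀ x y, c' x = c' y ↔ G.Reachable x y) ∧
      #(univ.image c') + m = #(univ.image c) := by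
  induction m generalizing H c with
  | zero =>
    rw [bridgeExt_zero, Set.mem_singleton_iff] at hG
    exact ⟨c, hG ▸ hc, rfl⟩
  | succ m ih =>
    obtain ⟨a, b, hr, hG'⟩ := exists_mem_bridgeExt_sup_edge hG
    obtain ⟨c', hc', hcard⟩ := ih (collapse_eq_iff hc a b) hG'
    refine ⟨c', hc', ?_⟩
    have hab : c a ≠ c b := fun h => hr ((hc a b).mp h)
    have himage : univ.image (collapse c (c a) (c b)) = (univ.image c).erase (c b) := by
      ext k
      simp only [mem_image, mem_univ, true_and, mem_erase, collapse]
      constructor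
      · rintro ⟨v, rfl⟩
        split_ifs with h
        · exact ⟨hab, a, rfl⟩
        · exact ⟨h, v, rfl⟩
      · rintro ⟨hk, v, rfl⟩
        exact ⟨v, if_neg hk⟩
    have hmem : c b ∈ univ.image c := mem_image_of_mem c (mem_univ b)
    rw [himage, card_erase_of_mem hmem] at hcard
    have := card_pos.mpr ⟨_, hmem⟩
    omega

lemma connected_iff_card_image_eq_one [Nonempty V] {c : V → ι}
    (hc : ∀ x y, c x = c y ↔ G.Reachable x y) : G.Connected ↔ #(univ.image c) = 1 := by
  rw [card_eq_one]
  constructor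
  · intro h
    obtain ⟨v⟩ := ‹Nonempty V›
    refine ⟨c v, eq_singleton_iff_unique_mem.mpr ⟨mem_image_of_mem c (mem_univ v), ?_⟩⟩
    intro k hk
    obtain ⟨u, -, rfl⟩ := mem_image.mp hk
    exact (hc u v).mpr (h.preconnected u v)
  · rintro ⟨k, hk⟩
    refine (connected_iff G).mpr ⟨fun x y => (hc x y).mp ?_, ‹_›⟩
    have hx (x : V) : c x = k := by
      rw [← mem_singleton, ← hk]
      exact mem_image_of_mem c (mem_univ x)
    rw [hx, hx]

lemma sum_labelWeight_mul [Fintype ι] (c : V → ι) (f : ι → ℝ) :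
    ∑ i, labelWeight c i * f i = ∑ v, f (c v) := by
  rw [← sum_fiberwise univ c]
  refine sum_congr rfl fun i _ => ?_
  rw [sum_congr rfl fun v hv => by rw [(mem_filter.mp hv).2], sum_const, nsmul_eq_mul, labelWeight]

lemma mergeSum_succ_labelWeight [Fintype ι] (m : ℕ) (c : V → ι) :
    mergeSum (m + 1) (labelWeight c) = ∑ a, ∑ b, if c a = c b then 0 else
      mergeSum m (labelWeight (collapse c (c a) (c b))) := by
  have h (i : ι) : (∑ j, if i = j then 0 else labelWeight c i * labelWeight c j *
      mergeSum m (merge (labelWeight c) i j)) =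
      labelWeight c i * ∑ b, if i = c b then 0 else mergeSum m (merge (labelWeight c) i (c b)) := by
    rw [← sum_labelWeight_mul c fun j => if i = j then 0 else mergeSum m (merge (labelWeight c) i j),
      mul_sum]
    refine sum_congr rfl fun j _ => ?_
    split_ifs <;> ring
  rw [mergeSum_succ, sum_congr rfl fun i _ => h i,
    sum_labelWeight_mul c fun i => ∑ b, if i = c b then 0 else mergeSum m (merge _ i (c b))]
  refine sum_congr rfl fun a _ => sum_congr rfl fun b _ => ?_
  split_ifs with hab
  · rfl
  · rw [labelWeight_collapse c hab]

open Classical in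
lemma sum_sum_ite_mem_edgeSet (K : SimpleGraph V) :
    ∑ a, ∑ b, (if s(a, b) ∈ K.edgeSet then 1 else 0) = 2 * K.edgeSet.ncard := by
  have hcard : K.edgeSet.ncard = #K.edgeFinset := by
    rw [← coe_edgeFinset, Set.ncard_coe_finset]
  rw [hcard, ← K.sum_degrees_eq_twice_card_edges]
  refine sum_congr rfl fun a _ => ?_
  rw [← card_neighborFinset_eq_degree, neighborFinset_eq_filter, card_filter]
  simp

open Classical in
lemma sum_sum_ncard_bridgeExt (H : SimpleGraph V) (m : ℕ) :
    ∑ a, ∑ b, (if H.Reachable a b then 0 else (bridgeExt (H ⊔ edge a b) m).ncard) =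
      2 * (m + 1) * (bridgeExt H (m + 1)).ncard := by
  have h1 (a b : V) : (if H.Reachable a b then 0 else (bridgeExt (H ⊔ edge a b) m).ncard) =
      ∑ G ∈ (bridgeExt H (m + 1)).toFinset, if s(a, b) ∈ (G \ H).edgeSet then 1 else 0 := by
    rw [← card_filter]
    split_ifs with hr
    · rw [eq_comm, card_eq_zero, filter_eq_empty_iff]
      intro G hG hab
      rw [edgeSet_sdiff] at hab
      exact ((mem_bridgeExt_succ_iff m a b).mp ⟨Set.mem_toFinset.mp hG, hab⟩).1 hr
    · rw [← Set.ncard_coe_finset]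
      congr 1
      ext G
      rw [coe_filter, Set.mem_ofPred_eq, Set.mem_toFinset, edgeSet_sdiff, mem_bridgeExt_succ_iff]
      exact ⟨fun h => ⟨hr, h⟩, fun h => h.2⟩
  simp only [h1]
  rw [sum_congr rfl fun a _ => sum_comm, sum_comm]
  have h2 : ∀ G ∈ (bridgeExt H (m + 1)).toFinset,
      ∑ a, ∑ b, (if s(a, b) ∈ (G \ H).edgeSet then 1 else 0) = 2 * (m + 1) := by
    intro G hG
    have h := sum_sum_ite_mem_edgeSet (G \ H)
    rw [congrArg Set.ncard (edgeSet_sdiff G H), (Set.mem_toFinset.mp hG).2] at h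
    convert h
  rw [sum_congr rfl h2, sum_const, smul_eq_mul, Set.ncard_eq_toFinset_card', mul_comm]

lemma mergeSum_labelWeight [Fintype ι] (m : ℕ) {c : V → ι}
    (hc : ∀ x y, c x = c y ↔ H.Reachable x y) :
    mergeSum m (labelWeight c) = 2 ^ m * m.factorial * (bridgeExt H m).ncard := by
  classical
  induction m generalizing H c with
  | zero => simp [bridgeExt_zero, mergeSum]
  | succ m ih =>
    have h (a b : V) : (if c a = c b then 0 else
        mergeSum m (labelWeight (collapse c (c a) (c b)))) = (2 : ℝ) ^ m * m.factorial *
        ((if H.Reachable a b then 0 else (bridgeExt (H ⊔ edge a b) m).ncard : ℕ) : ℝ) := by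
      rw [ih (collapse_eq_iff hc a b)]
      simp only [hc a b]
      split_ifs <;> simp
    rw [mergeSum_succ_labelWeight]
    simp only [h, ← mul_sum, ← Nat.cast_sum]
    rw [sum_sum_ncard_bridgeExt, Nat.factorial_succ]
    push_cast
    ring

lemma mergeCount_labelWeight [Fintype ι] (m : ℕ) {c : V → ι}
    (hc : ∀ x y, c x = c y ↔ H.Reachable x y) :
    mergeCount m (labelWeight c) = (bridgeExt H m).ncard := by
  rw [mergeCount, mergeSum_labelWeight m hc]
  field_simp

lemma lt_card_image_of_mem_bridgeExt [Nonempty V] {m : ℕ} {c : V → ι}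
    (hc : ∀ x y, c x = c y ↔ H.Reachable x y) (hG : G ∈ bridgeExt H m) :
    m < #(univ.image c) := by
  obtain ⟨c', -, hcard⟩ := exists_label_of_mem_bridgeExt hc hG
  have : 0 < #(univ.image c') := card_pos.mpr (univ_nonempty.image c')
  omega

lemma ncard_bridgeClass [Fintype ι] [Nonempty V] {c : V → ι}
    (hc : ∀ x y, c x = c y ↔ H.Reachable x y) :
    ((bridgeClass H).ncard : ℝ) =
      ∑ m ∈ range #(univ.image c), mergeCount m (labelWeight c) := by
  classical
  rw [sum_congr rfl fun m _ => mergeCount_labelWeight m hc, ← Nat.cast_sum, Nat.cast_inj,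
    Set.ncard_eq_toFinset_card', card_eq_sum_card_fiberwise
      (f := fun G => (G.edgeSet \ H.edgeSet).ncard) (t := range #(univ.image c))]
  · refine sum_congr rfl fun m _ => ?_
    rw [← Set.ncard_coe_finset]
    congr 1
    ext G
    simp [bridgeExt]
  · intro G hG
    exact mem_coe.mpr (mem_range.mpr (lt_card_image_of_mem_bridgeExt hc
      ⟨Set.mem_toFinset.mp hG, rfl⟩))

lemma ncard_connected_bridgeClass [Fintype ι] [Nonempty V] {c : V → ι}
    (hc : ∀ x y, c x = c y ↔ H.Reachable x y) :
    ({G ∈ bridgeClass H | G.Connected}.ncard : ℝ) =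
      mergeCount (#(univ.image c) - 1) (labelWeight c) := by
  rw [mergeCount_labelWeight _ hc]
  congr 2
  ext G
  have hpos : 0 < #(univ.image c) := card_pos.mpr (univ_nonempty.image c)
  refine and_congr_right fun hG => ?_
  obtain ⟨c', hc', hcard⟩ := exists_label_of_mem_bridgeExt hc ⟨hG, rfl⟩
  rw [connected_iff_card_image_eq_one hc']
  omega

end Labels

/-- The graph obtained from `G` by removing all its bridges. -/
def bridgelessCore (G : SimpleGraph V) : SimpleGraph V := G.deleteEdges {e | G.IsBridge e}

lemma edgeSet_bridgelessCore (G : SimpleGraph V) :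
    (bridgelessCore G).edgeSet = G.edgeSet \ {e | G.IsBridge e} := edgeSet_deleteEdges _

lemma mem_bridgeClass_bridgelessCore (G : SimpleGraph V) : G ∈ bridgeClass (bridgelessCore G) := by
  refine ⟨deleteEdges_le _, fun e he => ?_⟩
  rw [edgeSet_bridgelessCore] at he
  by_contra h
  exact he.2 ⟨he.1, h⟩

lemma bridgelessCore_eq_iff {G₀ : SimpleGraph V} :
    bridgelessCore G = bridgelessCore G₀ ↔ G ∈ bridgeClass (bridgelessCore G₀) := by
  constructor
  · intro h
    rw [← h]
    exact mem_bridgeClass_bridgelessCore G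
  · rintro ⟨hle, hb⟩
    rw [← edgeSet_inj]
    ext e
    rw [edgeSet_bridgelessCore G]
    constructor
    · rintro ⟨he, heb⟩
      by_contra h
      exact heb (hb e ⟨he, h⟩)
    · intro he
      refine ⟨edgeSet_mono hle he, fun heb => ?_⟩
      have hmem := mem_bridgeClass_bridgelessCore G₀
      have h := isBridge_of_isBridge_of_forall_isBridge hmem.1 hmem.2 he (heb.anti hle)
      rw [edgeSet_bridgelessCore] at he
      exact he.2 h

lemma BridgeAlterable.mem_iff_of_mem_bridgeExt {n : ℕ} {A : Set (SimpleGraph (Fin n))}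
    (hA : BridgeAlterable A) {m : ℕ} {G H : SimpleGraph (Fin n)} (hG : G ∈ bridgeExt H m) :
    G ∈ A ↔ H ∈ A := by
  induction m generalizing H with
  | zero =>
    rw [bridgeExt_zero, Set.mem_singleton_iff] at hG
    rw [hG]
  | succ m ih =>
    obtain ⟨a, b, hr, hG'⟩ := exists_mem_bridgeExt_sup_edge hG
    rw [ih hG', hA _ s(a, b) (isBridge_sup_edge.mpr (IsBridge.of_not_reachable hr))]
    have hdel : (H ⊔ edge a b).deleteEdges {s(a, b)} = H := by
      rw [← edgeSet_inj, edgeSet_deleteEdges, edgeSet_sup,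
        edgeSet_edge_of_ne fun h : a = b => hr (h ▸ Reachable.refl a), Set.union_sdiff_right,
        Set.sdiff_singleton_eq_self]
      exact fun h => hr (Adj.reachable h)
    rw [hdel]

lemma BridgeAlterable.mem_iff_bridgelessCore_mem {n : ℕ} {A : Set (SimpleGraph (Fin n))}
    (hA : BridgeAlterable A) (G : SimpleGraph (Fin n)) : G ∈ A ↔ bridgelessCore G ∈ A :=
  hA.mem_iff_of_mem_bridgeExt ⟨mem_bridgeClass_bridgelessCore G, rfl⟩

lemma bridgeClass_bot : bridgeClass (⊥ : SimpleGraph V) = {F | F.IsAcyclic} := by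
  ext F
  simp [bridgeClass, isAcyclic_iff_forall_isBridge]

lemma bot_label {ι : Type*} {c : V → ι} (hc : Injective c) (x y : V) :
    c x = c y ↔ (⊥ : SimpleGraph V).Reachable x y := by
  rw [hc.eq_iff, reachable_bot]

lemma forestCount_treeCount_eq {ι : Type*} [Fintype ι] [DecidableEq ι] {S : Finset ι}
    (hS : S.Nonempty) :
    (forestCount #S : ℝ) = ∑ m ∈ range #S, mergeCount m (indicatorWeight S) ∧
      (treeCount #S : ℝ) = mergeCount (#S - 1) (indicatorWeight S) := by
  have : NeZero #S := ⟨hS.card_ne_zero⟩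
  let c : Fin #S → ι := fun k => S.equivFin.symm k
  have hc : Injective c := Subtype.val_injective.comp S.equivFin.symm.injective
  have himage : univ.image c = S := by
    ext k
    simp only [mem_image, mem_univ, true_and]
    constructor
    · rintro ⟨v, rfl⟩
      exact (S.equivFin.symm v).2
    · exact fun hk => ⟨S.equivFin ⟨k, hk⟩, by simp [c]⟩
  have h1 := ncard_bridgeClass (bot_label hc)
  have h2 := ncard_connected_bridgeClass (bot_label hc)
  rw [labelWeight_of_injective hc, himage, bridgeClass_bot] at h1 h2
  refine ⟨h1, ?_⟩
  rw [← h2, treeCount]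
  congr 2
  ext T
  exact ⟨fun h => ⟨h.isAcyclic, h.connected⟩, fun h => ⟨h.2, h.1⟩⟩

lemma exists_label (H : SimpleGraph V) : ∃ c : V → V, ∀ x y, c x = c y ↔ H.Reachable x y := by
  refine ⟨fun v => (H.connectedComponentMk v).out, fun x y => ?_⟩
  rw [← ConnectedComponent.eq]
  exact (LeftInverse.injective Quot.out_eq).eq_iff

lemma exists_ratio_mul_ncard_bridgeClass_le {n : ℕ} (hn : 1 ≤ n) (H : SimpleGraph (Fin n)) :
    ∃ t : ℕ, 1 ≤ t ∧ t ≤ n ∧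
      max (Real.exp (-(t : ℝ) / (n : ℝ))) ((treeCount t : ℝ) / (forestCount t : ℝ)) *
        (bridgeClass H).ncard ≤ {G ∈ bridgeClass H | G.Connected}.ncard := by
  have : NeZero n := ⟨by omega⟩
  obtain ⟨c, hc⟩ := exists_label H
  have hS : (univ.image c).Nonempty := univ_nonempty.image c
  have hw := labelWeight_eq_zero c
  have hw1 := one_le_labelWeight c
  refine ⟨#(univ.image c), hS.card_pos, ?_, ?_⟩
  · simpa using card_le_univ (univ.image c)
  obtain ⟨hF, hT⟩ := forestCount_treeCount_eq hS
  have hexp := sum_mergeCount_le_exp hw hw1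
  have hratio := sum_mergeCount_mul_le hS hw hw1
  rw [← ncard_bridgeClass hc, ← ncard_connected_bridgeClass hc] at hexp
  rw [← ncard_bridgeClass hc, ← ncard_connected_bridgeClass hc, ← hF, ← hT] at hratio
  have hW : ∑ i, labelWeight c i = n := by
    simpa using sum_labelWeight_mul c fun _ => 1
  rw [hW] at hexp
  rw [max_mul_of_nonneg _ _ (Nat.cast_nonneg _)]
  refine max_le ?_ ?_
  · rw [neg_div, Real.exp_neg, inv_mul_le_iff₀ (Real.exp_pos _), mul_comm]
    exact hexp
  · rw [div_mul_eq_mul_div]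
    refine div_le_of_le_mul₀ (Nat.cast_nonneg _) (Nat.cast_nonneg _) ?_
    rw [mul_comm, mul_comm (_ : ℝ) (forestCount _ : ℝ)]
    exact hratio

end BridgeExtensions

theorem connected_prob_ge_min_max (n : ℕ) (hn : 1 ≤ n)
    (A : Set (SimpleGraph (Fin n))) (hA : A.Nonempty) (halt : BridgeAlterable A) :
    sInf {r : ℝ | ∃ t : ℕ, 1 ≤ t ∧ t ≤ n ∧
        r = max (Real.exp (-(t : ℝ) / (n : ℝ)))
              ((treeCount t : ℝ) / (forestCount t : ℝ))}
      ≤ ({G ∈ A | G.Connected}.ncard : ℝ) / (A.ncard : ℝ) := by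
  classical
  set q := sInf {r : ℝ | ∃ t : ℕ, 1 ≤ t ∧ t ≤ n ∧
    r = max (Real.exp (-(t : ℝ) / (n : ℝ))) ((treeCount t : ℝ) / (forestCount t : ℝ))} with hq
  have hclass (H : SimpleGraph (Fin n)) :
      q * (bridgeClass H).ncard ≤ {G ∈ bridgeClass H | G.Connected}.ncard := by
    obtain ⟨t, ht1, htn, ht⟩ := exists_ratio_mul_ncard_bridgeClass_le hn H
    refine le_trans (mul_le_mul_of_nonneg_right (csInf_le ⟨0, ?_⟩ ⟨t, ht1, htn, rfl⟩)
      (Nat.cast_nonneg _)) ht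
    rintro r ⟨s, -, -, rfl⟩
    exact le_max_of_le_left (Real.exp_pos _).le
  have hfib {G₀ : SimpleGraph (Fin n)} (hG₀ : G₀ ∈ A) (G : SimpleGraph (Fin n)) :
      (G ∈ A ∧ bridgelessCore G = bridgelessCore G₀) ↔ G ∈ bridgeClass (bridgelessCore G₀) := by
    rw [bridgelessCore_eq_iff, and_iff_right_iff_imp, ← bridgelessCore_eq_iff]
    intro h
    rwa [halt.mem_iff_bridgelessCore_mem, h, ← halt.mem_iff_bridgelessCore_mem]
  rw [le_div_iff₀ (Nat.cast_pos.mpr ((Set.ncard_pos A.toFinite).mpr hA)),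
    Set.ncard_eq_toFinset_card' A, Set.ncard_eq_toFinset_card' {G ∈ A | G.Connected},
    card_eq_sum_card_fiberwise (f := bridgelessCore) (t := A.toFinset.image bridgelessCore)
      (fun G hG => mem_coe.mpr (mem_image_of_mem _ hG)),
    card_eq_sum_card_fiberwise (s := Set.toFinset {G ∈ A | G.Connected}) (f := bridgelessCore)
      (t := A.toFinset.image bridgelessCore)
      (fun G hG => mem_coe.mpr (mem_image_of_mem _
        (Set.mem_toFinset.mpr (Set.mem_toFinset.mp hG).1))), Nat.cast_sum, Nat.cast_sum, mul_sum]
  refine sum_le_sum fun H hH => ?_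
  obtain ⟨G₀, hG₀, rfl⟩ := mem_image.mp hH
  have hfib := hfib (Set.mem_toFinset.mp hG₀)
  have h1 : #{G ∈ A.toFinset | bridgelessCore G = bridgelessCore G₀} =
      (bridgeClass (bridgelessCore G₀)).ncard := by
    rw [← Set.ncard_coe_finset]
    congr 1
    ext G
    simp [← hfib]
  have h2 : #{G ∈ Set.toFinset {G ∈ A | G.Connected} | bridgelessCore G = bridgelessCore G₀} =
      {G ∈ bridgeClass (bridgelessCore G₀) | G.Connected}.ncard := by
    rw [← Set.ncard_coe_finset]
    congr 1
    ext G
    simp only [coe_filter, Set.mem_toFinset, Set.mem_ofPred_eq, ← hfib]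
    tauto
  rw [h1, h2]
  exact hclass (bridgelessCore G₀)
end

section
/- Let t ≥ 3 be an integer, let n₁,…,n_t be positive integers with n = n₁ + ⋯ + n_t, and let N = ∏_{i=1}^t nᵢ. Then for every integer k with 1 ≤ k ≤ t, the set ℱₜᵏ of forests on {1,…,t} with exactly k connected components satisfies mass(ℱₜᵏ) ≤ N · (n/t)^{t-2} · |ℱₜᵏ|. -/
/-- The degree of vertex `v` in `G` (the number of neighbours of `v`). -/
noncomputable def deg {t : ℕ} (G : SimpleGraph (Fin t)) (v : Fin t) : ℕ :=
  (G.neighborSet v).ncard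

/-- The mass of a graph `F` with respect to weights `w`: `∏ i, w i ^ d_F(i)`. -/
noncomputable def mass {t : ℕ} (w : Fin t → ℕ) (F : SimpleGraph (Fin t)) : ℝ :=
  ∏ i, (w i : ℝ) ^ deg F i

/-- The total mass of a set of graphs. -/
noncomputable def massSet {t : ℕ} (w : Fin t → ℕ) (S : Set (SimpleGraph (Fin t))) : ℝ :=
  ∑ᶠ F ∈ S, mass w F

/-- The set of forests on `{1,…,t}` with exactly `k` connected components. -/
def forestsWithComponents (t k : ℕ) : Set (SimpleGraph (Fin t)) :=
  {F : SimpleGraph (Fin t) | F.IsAcyclic ∧ Nat.card F.ConnectedComponent = k}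

open Finset

section ParentMap

variable {V : Type*} {ρ p q : V → V} {b : V}

/-- Iterating `p` from the given vertex eventually leads to a fixed point of `ρ`. -/
inductive ReachesRoot (ρ p : V → V) : V → Prop
  | root (v : V) : ρ v = v → ReachesRoot ρ p v
  | step (v : V) : ReachesRoot ρ p (p v) → ReachesRoot ρ p v

/-- `p` is the parent map of a rooted forest whose trees are the fibres of `ρ`, the tree containing
`v` being rooted at `ρ v`; roots are their own parents. -/
structure IsParentMap (ρ p : V → V) : Prop where
  map_eq : ∀ v, ρ (p v) = ρ v
  root_eq : ∀ v, ρ v = v → p v = v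
  reaches : ∀ v, ReachesRoot ρ p v

theorem isParentMap_self (hρ : ∀ v, ρ (ρ v) = ρ v) : IsParentMap ρ ρ :=
  ⟨hρ, fun _ h => h, fun v => .step v (.root _ (hρ v))⟩

theorem IsParentMap.iterate_succ_ne (hp : IsParentMap ρ p) {v : V} (hv : ρ v ≠ v) (m : ℕ) :
    p^[m + 1] v ≠ v := by
  have hv' := hp.reaches v
  induction hv' with
  | root v h => exact absurd h hv
  | step v _ ih =>
    intro h
    have h' : p^[m + 1] (p v) = p v := by
      rw [← Function.iterate_succ_apply, Function.iterate_succ_apply', h]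
    refine ih (fun hr => hv ?_) h'
    have hfix : ∀ k, p^[k] (p v) = p v := fun k => Function.iterate_fixed (hp.root_eq _ hr) k
    rw [Function.iterate_succ_apply, hfix] at h
    rwa [h] at hr

theorem IsParentMap.apply_ne (hp : IsParentMap ρ p) {v : V} (hv : ρ v ≠ v) : p v ≠ v :=
  hp.iterate_succ_ne hv 0

theorem ReachesRoot.of_iterate {v : V} (k : ℕ) (h : ReachesRoot ρ p (p^[k] v)) :
    ReachesRoot ρ p v := by
  induction k generalizing v with
  | zero => exact h
  | succ k ih => exact .step v (ih h)

/-- The last vertex before the root on the way up from `b` is reached also by every map that agrees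
with `q` away from the children of the root. -/
theorem IsParentMap.exists_child_above (hq : IsParentMap ρ q) (hb : ρ b ≠ b) :
    ∃ c, ρ c ≠ c ∧ q c = ρ b ∧
      ∀ p : V → V, (∀ v, q v ≠ ρ b → p v = q v) → ∃ l, p^[l] b = c := by
  have hb' := hq.reaches b
  induction hb' with
  | root v h => exact absurd h hb
  | step v _ ih =>
    by_cases hv : q v = ρ v
    · exact ⟨v, hb, hv, fun p _ => ⟨0, rfl⟩⟩
    · have hne : ρ (q v) ≠ q v := by rw [hq.map_eq]; exact fun h => hv h.symm
      obtain ⟨c, hc, hqc, hl⟩ := ih hne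
      rw [hq.map_eq] at hqc hl
      refine ⟨c, hc, hqc, fun p hp => ?_⟩
      obtain ⟨l, hl⟩ := hl p hp
      exact ⟨l + 1, by rw [Function.iterate_succ_apply, hp v hv, hl]⟩

variable [DecidableEq V]

/-- Moving all children of `b` to the root of its tree. -/
theorem IsParentMap.redirect (hρ : ∀ v, ρ (ρ v) = ρ v) (hp : IsParentMap ρ p) :
    IsParentMap ρ (fun v => if p v = b then ρ b else p v) where
  map_eq v := by
    by_cases h : p v = b
    · simp [h, hρ, ← hp.map_eq v]
    · simp [h, hp.map_eq v]
  root_eq v hv := by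
    have := hp.root_eq v hv
    by_cases h : p v = b
    · have : v = b := by rw [← h, this]
      subst this
      simp [h, hv]
    · simpa only [h, if_false] using this
  reaches v := by
    have hv := hp.reaches v
    induction hv with
    | root v h => exact .root v h
    | step v _ ih =>
      refine .step v ?_
      by_cases h : p v = b
      · simpa [h] using ReachesRoot.root _ (hρ b)
      · simpa [h] using ih

/-- Moving some children of the root to `b`, none of them above `b`. -/
theorem IsParentMap.attach (hq : IsParentMap ρ q) (hρ : ∀ v, ρ (ρ v) = ρ v) {c : V}
    (hqc : q c = ρ b)
    (hl : ∀ p : V → V, (∀ v, q v ≠ ρ b → p v = q v) → ∃ l, p^[l] b = c)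
    {T : Finset V} (hT : ∀ v ∈ T, ρ v ≠ v ∧ q v = ρ b) (hcT : c ∉ T) :
    IsParentMap ρ (fun v => if v ∈ T then b else q v) where
  map_eq v := by
    by_cases h : v ∈ T
    · simp only [h, if_true]
      rw [← hq.map_eq v, (hT v h).2, hρ]
    · simp [h, hq.map_eq v]
  root_eq v hv := by
    have h : v ∉ T := fun h => (hT v h).1 hv
    simp [h, hq.root_eq v hv]
  reaches v := by
    have hb : ReachesRoot ρ (fun v => if v ∈ T then b else q v) b := by
      obtain ⟨l, hl⟩ := hl (fun v => if v ∈ T then b else q v)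
        (fun v hv => if_neg fun h => hv (hT v h).2)
      refine .of_iterate l ?_
      rw [hl]
      refine .step c ?_
      simpa [hcT, hqc] using ReachesRoot.root _ (hρ b)
    have hv := hq.reaches v
    induction hv with
    | root v h => exact .root v h
    | step v _ ih =>
      refine .step v ?_
      by_cases h : v ∈ T
      · simpa [h] using hb
      · simpa [h] using ih

variable [Fintype V]

open Classical in
/-- The set of parent maps with root map `ρ`. -/
noncomputable def parentMaps (ρ : V → V) : Finset (V → V) := {p | IsParentMap ρ p}

/-- The weight of a parent map: every non-root vertex contributes the weight of its parent. -/
noncomputable def parentWeight (ρ : V → V) (x : V → ℝ) (p : V → V) : ℝ :=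
  ∏ v with ρ v ≠ v, x (p v)

theorem mem_parentMaps : p ∈ parentMaps ρ ↔ IsParentMap ρ p := by simp [parentMaps]

theorem sum_parentWeight_fiber (hρ : ∀ v, ρ (ρ v) = ρ v) (hb : ρ b ≠ b) (hq : IsParentMap ρ q)
    (hbq : ∀ v, q v ≠ b) {x y : V → ℝ} (hyr : y (ρ b) = x (ρ b) + x b)
    (hy : ∀ v, v ≠ b → v ≠ ρ b → y v = x v) :
    (∑ p ∈ parentMaps ρ with (fun v => if p v = b then ρ b else p v) = q, parentWeight ρ x p)
      * y (ρ b) = parentWeight ρ y q * x (ρ b) := by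
  obtain ⟨c, hc, hqc, hl⟩ := hq.exists_child_above hb
  set A : Finset V := {v | ρ v ≠ v ∧ q v = ρ b ∧ v ≠ c} with hA
  set R : Finset V := {v | ρ v ≠ v ∧ q v ≠ ρ b} with hR
  have hcA : c ∉ A := by simp [hA]
  have hsplit : ∀ f : V → ℝ, ∏ v with ρ v ≠ v, f v = (∏ v ∈ A, f v) * f c * ∏ v ∈ R, f v := by
    intro f
    have h1 : (Finset.univ.filter fun v => ρ v ≠ v) = (insert c A) ∪ R := by
      ext v
      simp only [hA, hR, mem_filter, mem_univ, true_and, mem_union, mem_insert]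
      by_cases hvc : v = c
      · subst hvc; simp [hc]
      · tauto
    have h2 : Disjoint (insert c A) R := by
      rw [Finset.disjoint_left]
      intro v hv hv'
      simp only [hA, hR, mem_filter, mem_univ, true_and, mem_insert] at hv hv'
      rcases hv with rfl | hv
      · exact hv'.2 hqc
      · exact hv'.2 hv.2.1
    rw [h1, prod_union h2, prod_insert hcA]
    ring
  have hsum : ∑ p ∈ parentMaps ρ with (fun v => if p v = b then ρ b else p v) = q,
      parentWeight ρ x p
      = ∑ T ∈ A.powerset, (∏ v ∈ T, x b) * (∏ v ∈ A \ T, x (ρ b)) * x (ρ b)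
          * ∏ v ∈ R, x (q v) := by
    symm
    refine Finset.sum_bij' (fun T _ v => if v ∈ T then b else q v)
      (fun p _ => univ.filter fun v => p v = b) ?_ ?_ ?_ ?_ ?_
    · intro T hT
      rw [mem_powerset] at hT
      have hT' : ∀ v ∈ T, ρ v ≠ v ∧ q v = ρ b := fun v hv => by
        have := hT hv
        simp only [hA, mem_filter] at this
        exact ⟨this.2.1, this.2.2.1⟩
      rw [mem_filter, mem_parentMaps]
      refine ⟨hq.attach hρ hqc hl hT' (fun h => hcA (hT h)), ?_⟩
      funext v
      by_cases hv : v ∈ T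
      · simp [hv, (hT' v hv).2]
      · simp [hv, hbq v]
    · intro p hp
      rw [mem_filter, mem_parentMaps] at hp
      obtain ⟨hp, hpq⟩ := hp
      rw [mem_powerset]
      intro v hv
      simp only [mem_filter, mem_univ, true_and] at hv
      simp only [hA, mem_filter, mem_univ, true_and]
      refine ⟨fun h => hb ?_, ?_, ?_⟩
      · have := hp.root_eq v h
        rw [← hv, this, h]
      · rw [← hpq]; simp [hv]
      · rintro rfl
        obtain ⟨l, hl⟩ := hl p (fun u hu => by
          have hu' := congrFun hpq u
          by_cases h : p u = b
          · simp only [h, if_true] at hu'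
            exact absurd hu'.symm hu
          · simpa [h] using hu')
        refine hp.iterate_succ_ne hb l ?_
        rw [Function.iterate_succ_apply', hl, hv]
    · intro T hT
      ext v
      by_cases hv : v ∈ T
      · simp [hv]
      · simp [hv, hbq v]
    · intro p hp
      rw [mem_filter] at hp
      funext v
      by_cases hv : p v = b
      · simp [hv]
      · have := congrFun hp.2 v
        simp only [hv, if_false] at this
        simp [this, hbq v]
    · intro T hT
      rw [mem_powerset] at hT
      have hcT : c ∉ T := fun h => hcA (hT h)
      rw [parentWeight, hsplit, ← prod_sdiff hT]
      simp only [hcT, if_false, hqc]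
      have e1 : ∏ v ∈ A \ T, x (if v ∈ T then b else q v) = ∏ v ∈ A \ T, x (ρ b) :=
        prod_congr rfl fun v hv => by
          rw [mem_sdiff] at hv
          have : q v = ρ b := by
            have := hv.1
            simp only [hA, mem_filter] at this
            exact this.2.2.1
          simp [hv.2, this]
      have e2 : ∏ v ∈ T, x (if v ∈ T then b else q v) = ∏ v ∈ T, x b :=
        prod_congr rfl fun v hv => by simp [hv]
      have e3 : ∏ v ∈ R, x (if v ∈ T then b else q v) = ∏ v ∈ R, x (q v) :=
        prod_congr rfl fun v hv => by
          have : v ∉ T := fun h => by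
            have h1 := hT h
            simp only [hA, mem_filter] at h1
            simp only [hR, mem_filter] at hv
            exact hv.2.2 h1.2.2.1
          simp [this]
      rw [e1, e2, e3]
      ring
  have hR' : ∏ v ∈ R, y (q v) = ∏ v ∈ R, x (q v) :=
    prod_congr rfl fun v hv => by
      simp only [hR, mem_filter] at hv
      exact hy _ (hbq v) hv.2.2
  have hA' : ∏ v ∈ A, y (q v) = ∏ v ∈ A, (x b + x (ρ b)) :=
    prod_congr rfl fun v hv => by
      simp only [hA, mem_filter] at hv
      rw [hv.2.2.1, hyr, add_comm]
  rw [hsum, ← sum_mul, ← sum_mul, ← prod_add, parentWeight, hsplit, hR', hA', hqc]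
  ring

theorem sum_parentWeight_transfer (hρ : ∀ v, ρ (ρ v) = ρ v) (hb : ρ b ≠ b) {x y : V → ℝ}
    (hyb : y b = 0) (hyr : y (ρ b) = x (ρ b) + x b)
    (hy : ∀ v, v ≠ b → v ≠ ρ b → y v = x v) :
    (∑ p ∈ parentMaps ρ, parentWeight ρ x p) * y (ρ b)
      = (∑ p ∈ parentMaps ρ, parentWeight ρ y p) * x (ρ b) := by
  classical
  have h1 : ∀ p ∈ parentMaps ρ, (fun v => if p v = b then ρ b else p v)
      ∈ (parentMaps ρ).filter (fun q => ∀ v, q v ≠ b) := by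
    intro p hp
    rw [mem_filter, mem_parentMaps]
    refine ⟨(mem_parentMaps.1 hp).redirect hρ, fun v => ?_⟩
    by_cases h : p v = b
    · simpa [h] using hb
    · simp [h]
  have h2 : ∑ p ∈ parentMaps ρ, parentWeight ρ y p
      = ∑ p ∈ parentMaps ρ with ∀ v, p v ≠ b, parentWeight ρ y p := by
    symm
    refine sum_subset (filter_subset _ _) fun p hp hp' => ?_
    rw [mem_filter, not_and] at hp'
    have := hp' hp
    push Not at this
    obtain ⟨v, hv⟩ := this
    refine prod_eq_zero (i := v) ?_ (by rw [hv, hyb])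
    rw [mem_filter]
    refine ⟨mem_univ _, fun h => hb ?_⟩
    rw [← hv, (mem_parentMaps.1 hp).root_eq v h, h]
  rw [h2, ← sum_fiberwise_of_maps_to h1, sum_mul, sum_mul]
  refine sum_congr rfl fun q hq => ?_
  rw [mem_filter, mem_parentMaps] at hq
  exact sum_parentWeight_fiber hρ hb hq.1 hq.2 hyr hy

/-- Weighted count of rooted forests with prescribed vertex sets and roots of the trees. -/
theorem sum_parentWeight_mul (hρ : ∀ v, ρ (ρ v) = ρ v) (x : V → ℝ)
    (hx : ∀ v, 0 ≤ x v) (hx' : ∀ v, ρ v = v → 0 < x v) :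
    (∑ p ∈ parentMaps ρ, parentWeight ρ x p) * ∏ v with ρ v = v, ∑ u with ρ u = ρ v, x u
      = (∏ v with ρ v = v, x v) * ∏ v with ρ v ≠ v, ∑ u with ρ u = ρ v, x u := by
  induction hn : #{v | ρ v ≠ v ∧ x v ≠ 0} generalizing x with
  | zero =>
    have hz : ∀ v, ρ v ≠ v → x v = 0 := by
      intro v hv
      by_contra h
      rw [card_eq_zero] at hn
      have : v ∈ (∅ : Finset V) := by rw [← hn]; simp [hv, h]
      simp at this
    have hS : ∀ v, ∑ u with ρ u = ρ v, x u = x (ρ v) := by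
      intro v
      refine sum_eq_single_of_mem _ (by simp [hρ]) fun u hu hne => hz u fun h => hne ?_
      simp only [mem_filter] at hu
      rw [← h, hu.2]
    have hG : ∑ p ∈ parentMaps ρ, parentWeight ρ x p = ∏ v with ρ v ≠ v, x (ρ v) := by
      refine sum_eq_single_of_mem ρ (mem_parentMaps.2 (isParentMap_self hρ)) fun p hp hne => ?_
      have hp := mem_parentMaps.1 hp
      obtain ⟨v, hv⟩ := Function.ne_iff.1 hne
      refine prod_eq_zero (i := v) ?_ (hz _ ?_)
      · rw [mem_filter]
        exact ⟨mem_univ _, fun h => hv (by rw [hp.root_eq v h, h])⟩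
      · rw [hp.map_eq]
        exact hv.symm
    rw [hG, mul_comm]
    congr 1
    · refine prod_congr rfl fun v hv => ?_
      simp only [mem_filter] at hv
      rw [hS, hv.2]
    · exact prod_congr rfl fun v _ => (hS v).symm
  | succ n ih =>
    have hne : (univ.filter fun v => ρ v ≠ v ∧ x v ≠ 0).Nonempty := by
      rw [← card_pos, hn]; omega
    obtain ⟨b, hbm⟩ := hne
    have hb := (mem_filter.1 hbm).2.1
    set y : V → ℝ := fun v => if v = b then 0 else if v = ρ b then x (ρ b) + x b else x v with hydef
    have hyb : y b = 0 := by simp [hydef]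
    have hyr : y (ρ b) = x (ρ b) + x b := by simp [hydef, hb]
    have hy : ∀ v, v ≠ b → v ≠ ρ b → y v = x v := fun v h1 h2 => by simp [hydef, h1, h2]
    have hposr : 0 < x (ρ b) := hx' _ (hρ b)
    have hypos : 0 < y (ρ b) := by rw [hyr]; linarith [hx b]
    have hy0 : ∀ v, 0 ≤ y v := by
      intro v
      by_cases h1 : v = b
      · rw [h1, hyb]
      by_cases h2 : v = ρ b
      · rw [h2]; exact hypos.le
      · rw [hy v h1 h2]; exact hx v
    have hy0' : ∀ v, ρ v = v → 0 < y v := by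
      intro v hv
      by_cases h2 : v = ρ b
      · rw [h2]; exact hypos
      · rw [hy v (fun h => hb (h ▸ hv)) h2]; exact hx' v hv
    have hcard : #{v | ρ v ≠ v ∧ y v ≠ 0} = n := by
      have : (univ.filter fun v => ρ v ≠ v ∧ y v ≠ 0)
          = (univ.filter fun v => ρ v ≠ v ∧ x v ≠ 0).erase b := by
        ext v
        simp only [mem_filter, mem_univ, true_and, mem_erase]
        by_cases h1 : v = b
        · simp [h1, hyb]
        by_cases h2 : v = ρ b
        · simp [h2, hρ]
        · simp [hy v h1 h2, h1]
      rw [this, card_erase_of_mem hbm, hn]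
      rfl
    have hS : ∀ v, ∑ u with ρ u = ρ v, y u = ∑ u with ρ u = ρ v, x u := by
      intro v
      by_cases hv : ρ b = ρ v
      · have m1 : b ∈ univ.filter (fun u => ρ u = ρ v) := by simp [hv]
        have m2 : ρ b ∈ (univ.filter (fun u => ρ u = ρ v)).erase b := by
          simp [hρ, hv, show ρ v ≠ b from hv ▸ hb]
        rw [← add_sum_erase _ x m1, ← add_sum_erase _ y m1, ← add_sum_erase _ x m2,
          ← add_sum_erase _ y m2, hyb, hyr]
        have : ∀ u ∈ ((univ.filter (fun u => ρ u = ρ v)).erase b).erase (ρ b), y u = x u := by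
          intro u hu
          simp only [mem_erase] at hu
          exact hy u hu.2.1 hu.1
        rw [sum_congr rfl this]
        ring
      · refine sum_congr rfl fun u hu => ?_
        simp only [mem_filter] at hu
        refine hy u ?_ ?_
        · rintro rfl; exact hv hu.2
        · rintro rfl; rw [hρ] at hu; exact hv hu.2
    have hprod : (∏ v with ρ v = v, y v) * x (ρ b) = (∏ v with ρ v = v, x v) * y (ρ b) := by
      have m : ρ b ∈ univ.filter (fun v => ρ v = v) := by simp [hρ]
      rw [← mul_prod_erase _ y m, ← mul_prod_erase _ x m]
      have : ∀ v ∈ (univ.filter (fun v => ρ v = v)).erase (ρ b), y v = x v := by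
        intro v hv
        simp only [mem_erase, mem_filter] at hv
        exact hy v (fun h => hb (h ▸ hv.2.2)) hv.1
      rw [prod_congr rfl this]
      ring
    have key := ih y hy0 hy0' hcard
    simp only [hS] at key
    have htr := sum_parentWeight_transfer hρ hb hyb hyr hy
    refine mul_right_cancel₀ hypos.ne' ?_
    linear_combination (∏ v with ρ v = v, ∑ u with ρ u = ρ v, x u) * htr + x (ρ b) * key
      + (∏ v with ρ v ≠ v, ∑ u with ρ u = ρ v, x u) * hprod

end ParentMap

section ParentGraph

variable {V : Type*} {ρ p q : V → V}

/-- The graph joining every vertex to its image under `p`. -/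
def parentGraph (p : V → V) : SimpleGraph V := SimpleGraph.fromRel fun u v => p u = v

theorem parentGraph_adj {u v : V} : (parentGraph p).Adj u v ↔ u ≠ v ∧ (p u = v ∨ p v = u) :=
  SimpleGraph.fromRel_adj _ _ _

theorem reachable_apply (v : V) : (parentGraph p).Reachable v (p v) := by
  by_cases h : v = p v
  · rw [← h]
  · exact (parentGraph_adj.2 ⟨h, .inl rfl⟩).reachable

theorem IsParentMap.reachable_root (hp : IsParentMap ρ p) (v : V) :
    (parentGraph p).Reachable v (ρ v) := by
  have hv := hp.reaches v
  induction hv with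
  | root v h => rw [h]
  | step v _ ih =>
    rw [hp.map_eq] at ih
    exact (reachable_apply v).trans ih

theorem IsParentMap.reachable_iff (hp : IsParentMap ρ p) (u v : V) :
    (parentGraph p).Reachable u v ↔ ρ u = ρ v := by
  constructor
  · rintro ⟨W⟩
    induction W with
    | nil => rfl
    | cons h _ ih =>
      rw [← ih]
      rcases (parentGraph_adj.1 h).2 with h | h
      · rw [← h, hp.map_eq]
      · rw [← h, hp.map_eq]
  · intro h
    have hv := hp.reachable_root v
    rw [← h] at hv
    exact (hp.reachable_root u).trans hv.symm

theorem IsParentMap.isAcyclic (hp : IsParentMap ρ p) : (parentGraph p).IsAcyclic := by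
  have key : ∀ v, v ≠ p v → (parentGraph p).IsBridge s(v, p v) := by
    intro v hv
    have hroot : ρ v ≠ v := fun h => hv (hp.root_eq v h).symm
    rw [SimpleGraph.isBridge_iff]
    have inv : ∀ a b, ((parentGraph p).deleteEdges {s(v, p v)}).Reachable a b →
        (∃ k, p^[k] a = v) → ∃ k, p^[k] b = v := by
      rintro a b ⟨W⟩
      induction W with
      | nil => exact id
      | @cons a c b h _ ih =>
        rintro ⟨k, hk⟩
        refine ih ?_
        rw [SimpleGraph.deleteEdges_adj, parentGraph_adj] at h
        obtain ⟨⟨_, hac | hca⟩, hne⟩ := h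
        · rcases k with _ | k
          · simp only [Function.iterate_zero, id_eq] at hk
            subst hk hac
            simp at hne
          · rw [Function.iterate_succ_apply, hac] at hk
            exact ⟨k, hk⟩
        · exact ⟨k + 1, by rw [Function.iterate_succ_apply, hca, hk]⟩
    intro hr
    obtain ⟨k, hk⟩ := inv _ _ hr ⟨0, rfl⟩
    exact hp.iterate_succ_ne hroot k hk
  rw [SimpleGraph.isAcyclic_iff_forall_adj_isBridge]
  intro u v huv
  obtain ⟨hne, rfl | rfl⟩ := parentGraph_adj.1 huv
  · exact key u hne
  · rw [Sym2.eq_swap]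
    exact key v hne.symm

theorem IsParentMap.eq_of_parentGraph_eq (hp : IsParentMap ρ p) (hq : IsParentMap ρ q)
    (h : parentGraph p = parentGraph q) : p = q := by
  funext v
  have hv := hp.reaches v
  induction hv with
  | root v hr => rw [hp.root_eq v hr, hq.root_eq v hr]
  | step v _ ih =>
    by_cases hr : ρ v = v
    · rw [hp.root_eq v hr, hq.root_eq v hr]
    have hadj : (parentGraph q).Adj v (p v) :=
      h ▸ parentGraph_adj.2 ⟨(hp.apply_ne hr).symm, .inl rfl⟩
    rcases (parentGraph_adj.1 hadj).2 with h' | h'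
    · exact h'.symm
    · rw [← ih] at h'
      exact absurd h' (hp.iterate_succ_ne hr 1)

theorem exists_isParentMap_of_isAcyclic {F : SimpleGraph V} (hF : F.IsAcyclic)
    (hρ : ∀ v, ρ (ρ v) = ρ v) (hr : ∀ u v, F.Reachable u v ↔ ρ u = ρ v) :
    ∃ p, IsParentMap ρ p ∧ parentGraph p = F := by
  classical
  have hpath : ∀ v, ∃ W : F.Walk v (ρ v), W.IsPath := fun v =>
    ((hr v (ρ v)).2 (hρ v).symm).exists_isPath
  choose W hW using hpath
  have huniq : ∀ v (P : F.Walk v (ρ v)), P.IsPath → P = W v := fun v P hP =>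
    congrArg Subtype.val ((hF.subsingleton_path v (ρ v)).elim ⟨P, hP⟩ ⟨W v, hW v⟩)
  have hadj : ∀ v, ρ v ≠ v → F.Adj v (W v).snd := fun v hv =>
    (W v).adj_snd (SimpleGraph.Walk.not_nil_of_ne (Ne.symm hv))
  have hroot : ∀ v, ρ v = v → (W v).snd = v := by
    intro v hv
    have : ∀ w (P : F.Walk v w), P.IsPath → w = v → P.snd = v := by
      rintro w P hP rfl
      rw [(SimpleGraph.Walk.isPath_iff_nil.1 hP).eq_nil]
      rfl
    exact this _ _ (hW v) hv
  have hmap : ∀ v, ρ (W v).snd = ρ v := by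
    intro v
    by_cases hv : ρ v = v
    · rw [hroot v hv]
    · exact ((hr _ _).1 (hadj v hv).reachable).symm
  have hreach : ∀ w, ρ w = w → ∀ v (P : F.Walk v w), P.IsPath →
      ReachesRoot ρ (fun v => (W v).snd) v := by
    intro w hw v P hP
    induction P with
    | nil => exact .root _ hw
    | @cons v u w h P ih =>
      have hv : w = ρ v := by
        rw [← hw]
        exact ((hr _ _).1 ⟨SimpleGraph.Walk.cons h P⟩).symm
      subst hv
      have hsnd : (W v).snd = u := by
        rw [← huniq v _ hP]
        simp
      refine .step v ?_
      simp only [hsnd]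
      exact ih hw hP.of_cons
  refine ⟨fun v => (W v).snd, ⟨hmap, hroot, fun v => hreach _ (hρ v) v _ (hW v)⟩, ?_⟩
  ext u v
  rw [parentGraph_adj]
  constructor
  · rintro ⟨hne, h | h⟩
    · rw [← h]
      exact hadj u fun hu => hne (by rw [← h, hroot u hu])
    · rw [← h]
      exact (hadj v fun hv => hne (by rw [← h, hroot v hv])).symm
  · intro h
    refine ⟨h.ne, ?_⟩
    have huv : ρ u = ρ v := (hr _ _).1 h.reachable
    by_cases hv : v ∈ (W u).support
    · exact .inl (hF.eq_snd_of_adj_start (hW u) h hv).symm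
    · right
      have hP : (SimpleGraph.Walk.cons h.symm (W u)).IsPath := (hW u).cons hv
      have : ∀ w (hw : ρ u = w) (Q : F.Walk v w), Q.IsPath → Q.snd = u := by
        rintro w rfl Q hQ
        have : Q = SimpleGraph.Walk.cons h.symm (W u) :=
          congrArg Subtype.val ((hF.subsingleton_path v (ρ u)).elim ⟨Q, hQ⟩ ⟨_, hP⟩)
        rw [this]
        simp
      exact this _ huv _ (hW v)

theorem IsParentMap.mass_mul {t : ℕ} {ρ p : Fin t → Fin t} (hp : IsParentMap ρ p)
    (w : Fin t → ℕ) :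
    mass w (parentGraph p) * ∏ v with ρ v = v, (w v : ℝ)
      = (∏ v, (w v : ℝ)) * parentWeight ρ (fun v => (w v : ℝ)) p := by
  classical
  have hdeg : ∀ v, deg (parentGraph p) v
      = #{u ∈ univ.filter (fun u => ρ u ≠ u) | p u = v} + if ρ v ≠ v then 1 else 0 := by
    intro v
    have hset : (parentGraph p).neighborSet v
        = ((univ.filter (fun u => ρ u ≠ u)).filter (fun u => p u = v)
            ∪ if ρ v ≠ v then {p v} else ∅ : Finset (Fin t)) := by
      ext u
      rw [SimpleGraph.mem_neighborSet, parentGraph_adj]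
      by_cases hv : ρ v = v
      · have h1 := hp.root_eq v hv
        simp only [hv, ne_eq, not_true_eq_false, if_false, union_empty, mem_coe, mem_filter,
          mem_univ, true_and]
        constructor
        · rintro ⟨hne, h | h⟩
          · exact absurd (h1.symm.trans h) hne
          · exact ⟨fun hu => hne (by rw [← h, hp.root_eq u hu]), h⟩
        · rintro ⟨hu, h⟩
          exact ⟨fun e => hu (e ▸ hv), .inr h⟩
      · simp only [hv, ne_eq, not_false_eq_true, if_true, mem_coe, mem_union, mem_filter,
          mem_univ, true_and, mem_singleton]
        constructor
        · rintro ⟨hne, h | h⟩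
          · exact .inr h.symm
          · exact .inl ⟨fun hu => hne (by rw [← h, hp.root_eq u hu]), h⟩
        · rintro (⟨hu, h⟩ | h)
          · exact ⟨fun e => hp.apply_ne hv (by rw [e] at h ⊢; exact h), .inr h⟩
          · exact ⟨fun e => hp.apply_ne hv (by rw [← h, ← e]), .inl h.symm⟩
    rw [deg, hset, Set.ncard_coe_finset, card_union_of_disjoint]
    · split_ifs <;> simp
    · split_ifs with hv
      · rw [disjoint_singleton_right, mem_filter]
        exact fun h => hp.iterate_succ_ne hv 1 h.2
      · exact disjoint_empty_right _
  have h1 : mass w (parentGraph p)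
      = parentWeight ρ (fun v => (w v : ℝ)) p * ∏ v with ρ v ≠ v, (w v : ℝ) := by
    rw [mass, parentWeight, ← prod_fiberwise' _ p (fun v => (w v : ℝ)), prod_filter,
      ← prod_mul_distrib]
    refine prod_congr rfl fun v _ => ?_
    rw [hdeg, pow_add, prod_const]
    split_ifs <;> simp
  rw [h1, ← prod_filter_mul_prod_filter_not univ (fun v => ρ v = v) (fun v => (w v : ℝ))]
  ring

end ParentGraph

section Bound

variable {V : Type*} [Fintype V] [DecidableEq V] {ρ : V → V}

theorem prod_average_le (hρ : ∀ v, ρ (ρ v) = ρ v) (hV : 2 ≤ Fintype.card V) {y : V → ℝ}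
    (hy1 : ∀ v, 1 ≤ y v) (hyρ : ∀ v, y (ρ v) = y v) :
    ∏ v with ρ v ≠ v, y v
      ≤ ((∑ v, y v) / Fintype.card V) ^ (Fintype.card V - 2) * ∏ v with ρ v = v, y v := by
  set t := Fintype.card V with ht
  have hypos : ∀ v, 0 < y v := fun v => lt_of_lt_of_le one_pos (hy1 v)
  have htpos : (0 : ℝ) < t := by exact_mod_cast (by omega : 0 < t)
  have hsumt : (t : ℝ) ≤ ∑ v, y v := by
    have := Finset.card_nsmul_le_sum univ y 1 fun v _ => hy1 v
    simpa [ht] using this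
  set A : ℝ := (∑ v, y v) / t with hA
  have hApos : 0 < A := div_pos (htpos.trans_le hsumt) htpos
  have hlogroot : ∑ v, Real.log (y v) ≤ t * ∑ v with ρ v = v, Real.log (y v) := by
    have hmaps : ∀ v ∈ (univ : Finset V), ρ v ∈ univ.filter (fun v => ρ v = v) := by simp [hρ]
    rw [← sum_fiberwise_of_maps_to hmaps, mul_sum]
    refine sum_le_sum fun r _ => ?_
    have : ∀ v ∈ univ.filter (fun v => ρ v = r), Real.log (y v) = Real.log (y r) := by
      intro v hv
      rw [← (mem_filter.1 hv).2, hyρ]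
    rw [sum_congr rfl this, sum_const, nsmul_eq_mul]
    refine mul_le_mul_of_nonneg_right ?_ (Real.log_nonneg (hy1 r))
    exact_mod_cast card_le_univ _
  have hjensen : ∑ v, Real.log (y v) ≤ t * Real.log A := by
    have h : ∀ v, Real.log (y v) ≤ Real.log A + (y v / A - 1) := by
      intro v
      have := Real.log_le_sub_one_of_pos (div_pos (hypos v) hApos)
      rw [Real.log_div (hypos v).ne' hApos.ne'] at this
      linarith
    have hs : ∑ v, y v / A = t := by
      rw [← sum_div, hA, div_div_cancel₀ (htpos.trans_le hsumt).ne']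
    calc ∑ v, Real.log (y v) ≤ ∑ v, (Real.log A + (y v / A - 1)) := sum_le_sum fun v _ => h v
      _ = t * Real.log A := by
        rw [sum_add_distrib, sum_sub_distrib, hs]
        simp [ht]
  have hsplit := sum_filter_add_sum_filter_not univ (fun v => ρ v = v) (fun v => Real.log (y v))
  have ht2 : (2 : ℝ) ≤ t := by exact_mod_cast hV
  rw [← Real.log_le_log_iff (prod_pos fun v _ => hypos v)
      (mul_pos (pow_pos hApos _) (prod_pos fun v _ => hypos v)),
    Real.log_mul (pow_pos hApos _).ne' (prod_pos fun v _ => hypos v).ne', Real.log_pow,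
    Real.log_prod fun v _ => (hypos v).ne', Real.log_prod fun v _ => (hypos v).ne',
    Nat.cast_sub hV, Nat.cast_ofNat]
  refine le_of_mul_le_mul_left ?_ htpos
  nlinarith [mul_le_mul_of_nonneg_left hjensen (sub_nonneg.2 ht2)]

theorem prod_fiber_sum_le (hρ : ∀ v, ρ (ρ v) = ρ v) (hV : 2 ≤ Fintype.card V) {x : V → ℝ}
    (hx : ∀ v, 1 ≤ x v) :
    (∏ v with ρ v ≠ v, ∑ u with ρ u = ρ v, x u)
        * ∏ v with ρ v = v, ∑ u with ρ u = ρ v, (1 : ℝ)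
      ≤ ((∑ v, x v) / Fintype.card V) ^ (Fintype.card V - 2)
        * (∏ v with ρ v = v, ∑ u with ρ u = ρ v, x u)
        * ∏ v with ρ v ≠ v, ∑ u with ρ u = ρ v, (1 : ℝ) := by
  set c : V → ℝ := fun v => ∑ u with ρ u = ρ v, (1 : ℝ) with hc
  set y : V → ℝ := fun v => (∑ u with ρ u = ρ v, x u) / c v with hy
  have hcpos : ∀ v, 0 < c v := fun v => sum_pos (fun _ _ => one_pos) ⟨v, by simp⟩
  have hS : ∀ v, ∑ u with ρ u = ρ v, x u = y v * c v := fun v =>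
    (div_mul_cancel₀ _ (hcpos v).ne').symm
  have hy1 : ∀ v, 1 ≤ y v := fun v => by
    rw [hy, one_le_div (hcpos v)]
    exact sum_le_sum fun u _ => hx u
  have hyρ : ∀ v, y (ρ v) = y v := fun v => by simp only [hy, hc, hρ]
  have hsum : ∑ v, y v = ∑ v, x v := by
    simp only [hy, sum_div]
    rw [sum_comm' (t' := univ) (s' := fun u => univ.filter fun v => ρ u = ρ v) (by simp)]
    refine sum_congr rfl fun u _ => ?_
    have : ∀ v ∈ univ.filter (fun v => ρ u = ρ v), x u / c v = x u / c u := by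
      intro v hv
      simp only [hc, (mem_filter.1 hv).2]
    rw [sum_congr rfl this, sum_const, nsmul_eq_mul]
    have hcard : ((univ.filter (fun v => ρ u = ρ v)).card : ℝ) = c u := by
      simp [hc, eq_comm]
    rw [hcard, mul_div_cancel₀ _ (hcpos u).ne']
  have key := prod_average_le hρ hV hy1 hyρ
  rw [hsum] at key
  simp only [hS, prod_mul_distrib]
  have hpos : 0 ≤ (∏ v with ρ v ≠ v, c v) * ∏ v with ρ v = v, c v :=
    mul_nonneg (prod_nonneg fun v _ => (hcpos v).le) (prod_nonneg fun v _ => (hcpos v).le)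
  calc _ = (∏ v with ρ v ≠ v, y v)
        * ((∏ v with ρ v ≠ v, c v) * ∏ v with ρ v = v, c v) := by ring
    _ ≤ _ := mul_le_mul_of_nonneg_right key hpos
    _ = _ := by ring

end Bound

section Forests

variable {t : ℕ}

/-- The forests whose trees span exactly the fibres of `ρ`. -/
def forestsOver (ρ : Fin t → Fin t) : Set (SimpleGraph (Fin t)) :=
  {F | F.IsAcyclic ∧ ∀ u v, F.Reachable u v ↔ ρ u = ρ v}

variable {ρ : Fin t → Fin t}

theorem sum_forestsOver (hρ : ∀ v, ρ (ρ v) = ρ v) {S : Finset (SimpleGraph (Fin t))}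
    (hS : (S : Set (SimpleGraph (Fin t))) = forestsOver ρ) (w : Fin t → ℕ) (hw : ∀ v, 0 < w v) :
    (∑ F ∈ S, mass w F) * ∏ v with ρ v = v, ∑ u with ρ u = ρ v, (w u : ℝ)
      = (∏ v, (w v : ℝ)) * ∏ v with ρ v ≠ v, ∑ u with ρ u = ρ v, (w u : ℝ) := by
  classical
  have himage : S = (parentMaps ρ).image parentGraph := by
    ext F
    rw [← mem_coe, hS, mem_image]
    constructor
    · rintro ⟨hF, hr⟩
      obtain ⟨p, hp, rfl⟩ := exists_isParentMap_of_isAcyclic hF hρ hr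
      exact ⟨p, mem_parentMaps.2 hp, rfl⟩
    · rintro ⟨p, hp, rfl⟩
      exact ⟨(mem_parentMaps.1 hp).isAcyclic, (mem_parentMaps.1 hp).reachable_iff⟩
  have hsum : (∑ F ∈ S, mass w F) * ∏ v with ρ v = v, (w v : ℝ)
      = (∏ v, (w v : ℝ)) * ∑ p ∈ parentMaps ρ, parentWeight ρ (fun v => (w v : ℝ)) p := by
    rw [himage, sum_image fun p hp q hq h =>
      (mem_parentMaps.1 hp).eq_of_parentGraph_eq (mem_parentMaps.1 hq) h, sum_mul, mul_sum]
    exact sum_congr rfl fun p hp => (mem_parentMaps.1 hp).mass_mul w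
  have hw' : ∀ v, (0 : ℝ) < w v := fun v => by exact_mod_cast hw v
  have key := sum_parentWeight_mul hρ (fun v => (w v : ℝ)) (fun v => (hw' v).le) fun v _ => hw' v
  have hpos : ∏ v with ρ v = v, (w v : ℝ) ≠ 0 := (prod_pos fun v _ => hw' v).ne'
  refine mul_right_cancel₀ hpos ?_
  linear_combination (∏ v with ρ v = v, ∑ u with ρ u = ρ v, (w u : ℝ)) * hsum
    + (∏ v, (w v : ℝ)) * key

theorem mass_one (F : SimpleGraph (Fin t)) : mass (fun _ => 1) F = 1 := by simp [mass]

theorem sum_mass_forestsOver_le (ht : 2 ≤ t) (hρ : ∀ v, ρ (ρ v) = ρ v)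
    {S : Finset (SimpleGraph (Fin t))} (hS : (S : Set (SimpleGraph (Fin t))) = forestsOver ρ)
    (w : Fin t → ℕ) (hw : ∀ v, 0 < w v) :
    ∑ F ∈ S, mass w F ≤ (∏ i, (w i : ℝ)) * ((∑ i, (w i : ℝ)) / (t : ℝ)) ^ (t - 2) * #S := by
  have h1 := sum_forestsOver hρ hS w hw
  have h2 := sum_forestsOver hρ hS (fun _ => 1) fun _ => one_pos
  simp only [mass_one, sum_const, nsmul_eq_mul, mul_one, Nat.cast_one, prod_const_one,
    one_mul] at h2
  have hw' : ∀ v, (1 : ℝ) ≤ w v := fun v => by exact_mod_cast hw v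
  have h3 := prod_fiber_sum_le hρ (by simpa using ht) hw'
  simp only [sum_const, nsmul_eq_mul, mul_one, Fintype.card_fin] at h3
  have hN : (0 : ℝ) ≤ ∏ v, (w v : ℝ) := prod_nonneg fun v _ => Nat.cast_nonneg _
  have hposS : (0 : ℝ) < ∏ v with ρ v = v, ∑ u with ρ u = ρ v, (w u : ℝ) :=
    prod_pos fun v _ => sum_pos (fun u _ => one_pos.trans_le (hw' u)) ⟨v, by simp⟩
  have hposc : (0 : ℝ) < ∏ v with ρ v = v, (#{u | ρ u = ρ v} : ℝ) :=
    prod_pos fun v _ => by exact_mod_cast card_pos.2 ⟨v, by simp⟩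
  refine le_of_mul_le_mul_right ?_ (mul_pos hposS hposc)
  rw [← mul_assoc, h1, mul_assoc]
  refine (mul_le_mul_of_nonneg_left h3 hN).trans_eq ?_
  rw [← h2]
  ring

theorem exists_root_map (s : Setoid (Fin t)) :
    ∃ ρ : Fin t → Fin t, (∀ v, ρ (ρ v) = ρ v) ∧ ∀ u v, s u v ↔ ρ u = ρ v := by
  have hout : ∀ u v, s u v ↔ (Quotient.mk s u).out = (Quotient.mk s v).out := fun u v =>
    Quotient.eq.symm.trans Quotient.out_inj.symm
  exact ⟨fun v => (Quotient.mk s v).out, fun v => by simp, hout⟩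

end Forests

theorem mass_forests_k_components_le (t : ℕ) (ht : 3 ≤ t) (w : Fin t → ℕ)
    (hw : ∀ i, 0 < w i) (k : ℕ) (hk1 : 1 ≤ k) (hkt : k ≤ t) :
    massSet w (forestsWithComponents t k)
      ≤ (∏ i, (w i : ℝ)) * ((∑ i, (w i : ℝ)) / (t : ℝ)) ^ (t - 2)
          * ((forestsWithComponents t k).ncard : ℝ) := by
  classical
  obtain ⟨S, hS⟩ : ∃ S : Finset (SimpleGraph (Fin t)), (S : Set _) = forestsWithComponents t k :=
    ⟨(Set.toFinite (forestsWithComponents t k)).toFinset, by simp⟩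
  rw [massSet, ← hS, finsum_mem_coe_finset, Set.ncard_coe_finset]
  have hmaps : ∀ F ∈ S, F.reachableSetoid ∈ S.image SimpleGraph.reachableSetoid :=
    fun F hF => mem_image_of_mem _ hF
  rw [← sum_fiberwise_of_maps_to hmaps, card_eq_sum_card_fiberwise hmaps, Nat.cast_sum, mul_sum]
  refine sum_le_sum fun s hs => ?_
  obtain ⟨ρ, hρ, hsρ⟩ := exists_root_map s
  refine sum_mass_forestsOver_le (by omega) hρ ?_ w hw
  obtain ⟨F₀, hF₀, rfl⟩ := mem_image.1 hs
  have hk : Nat.card F₀.ConnectedComponent = k := by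
    have : F₀ ∈ forestsWithComponents t k := hS ▸ mem_coe.2 hF₀
    exact this.2
  ext F
  rw [coe_filter, Set.mem_ofPred_eq, ← mem_coe, hS]
  constructor
  · rintro ⟨⟨hF, _⟩, h⟩
    exact ⟨hF, fun u v => by rw [← hsρ, ← h]; rfl⟩
  · rintro ⟨hF, h⟩
    have hR : F.Reachable = F₀.Reachable := by
      funext u v
      exact propext ((h u v).trans (hsρ u v).symm)
    refine ⟨⟨hF, ?_⟩, ?_⟩
    · rw [← hk, SimpleGraph.ConnectedComponent, SimpleGraph.ConnectedComponent, hR]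
    · exact Setoid.ext fun u v => by
        change F.Reachable u v ↔ F₀.Reachable u v
        rw [hR]
end
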